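/- arXiv:2509.14035 — 6 statements merged into one kernel-verified Lean document; each statement's English description precedes it below -/
import Mathlib

section
/- There exists a probability distribution CC_ε(t) on ℤ^t such that: (1) for every pair of vectors x, x' ∈ {0,1}^t differing in at most one coordinate, with prefix-sum vectors s, s' ∈ ℤ^t given by s_j = ∑_{i≤j} x_i and s'_j = ∑_{i≤j} x'_i, and every v ∈ ℤ^t, Pr_{η∼CC_ε(t)}[s + η = v] ≤ e^ε · Pr_{η∼CC_ε(t)}[s' + η = v]; and (2) for every β ∈ (0,1), Pr_{η∼CC_ε(t)}[‖η‖_∞ ≥ (3/ε)·log₂(t)·ln(2t/β)] ≤ β. -/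
open scoped ENNReal

/-- The parent of node `k ≥ 1` in a forest of binary-indexed trees whose lowest `i` levels are
binary, and whose remaining top level is a chain. -/
def fenwickParent : ℕ → ℕ → ℕ
  | 0, k => k - 1
  | i + 1, k => if k % 2 = 0 then 2 * fenwickParent i (k / 2) else k - 1

/-- The number of steps `fenwickParent i` takes from `k` to reach `0`. -/
def fenwickDepth : ℕ → ℕ → ℕ
  | 0, k => k
  | i + 1, k => fenwickDepth i (k / 2) + k % 2

lemma fenwickParent_lt (i : ℕ) : ∀ k, 0 < k → fenwickParent i k < k := by
  induction i with
  | zero => intro k hk; simp only [fenwickParent]; omega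
  | succ i ih =>
    intro k hk
    simp only [fenwickParent]
    split_ifs with h
    · have := ih (k / 2) (by omega)
      omega
    · omega

lemma fenwickDepth_zero (i : ℕ) : fenwickDepth i 0 = 0 := by
  induction i with
  | zero => rfl
  | succ i ih => simpa [fenwickDepth] using ih

lemma fenwickDepth_eq (i : ℕ) :
    ∀ k, 0 < k → fenwickDepth i k = fenwickDepth i (fenwickParent i k) + 1 := by
  induction i with
  | zero => intro k hk; simp only [fenwickParent, fenwickDepth]; omega
  | succ i ih =>
    intro k hk
    simp only [fenwickParent, fenwickDepth]
    split_ifs with h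
    · rw [ih (k / 2) (by omega)]
      simp [h]
    · have h1 : (k - 1) / 2 = k / 2 := by omega
      rw [h1]
      omega

lemma pow_fenwickDepth_le (i : ℕ) :
    ∀ k, 0 < k → k < 2 ^ (i + 2) → ((16 : ℝ) / 9) ^ fenwickDepth i k ≤ 2 * k := by
  induction i with
  | zero =>
    intro k hk hk4
    norm_num at hk4
    interval_cases k <;> norm_num [fenwickDepth]
  | succ i ih =>
    intro k hk hk4
    simp only [fenwickDepth]
    rcases Nat.eq_zero_or_pos (k / 2) with h0 | h0
    · obtain rfl : k = 1 := by omega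
      norm_num [fenwickDepth_zero]
    · have h1 := ih (k / 2) h0 (by rw [pow_succ] at hk4; omega)
      have h2 : ((16 : ℝ) / 9) ^ (k % 2) ≤ 16 / 9 := by
        rcases Nat.mod_two_eq_zero_or_one k with h | h <;> rw [h] <;> norm_num
      have h3 : (2 : ℝ) * ((k / 2 : ℕ) : ℝ) ≤ k := by exact_mod_cast Nat.mul_div_le k 2
      rw [pow_add]
      calc _ ≤ (2 * ((k / 2 : ℕ) : ℝ)) * (16 / 9) := by gcongr
        _ ≤ 2 * k := by
          have : (0 : ℝ) ≤ k := by positivity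
          linarith

lemma card_fenwickParent_lt_le (i : ℕ) : ∀ T p, 0 < p →
    ((Finset.Icc 1 T).filter fun k => fenwickParent i k < p ∧ p ≤ k).card ≤ i + 1 := by
  induction i with
  | zero =>
    intro T p hp
    refine (Finset.card_le_card (t := {p}) ?_).trans (by simp)
    intro k
    simp only [Finset.mem_filter, Finset.mem_Icc, Finset.mem_singleton]
    simp only [fenwickParent]
    omega
  | succ i ih =>
    intro T p hp
    have hsub : ((Finset.Icc 1 T).filter fun k => fenwickParent (i + 1) k < p ∧ p ≤ k) ⊆
        insert p ((((Finset.Icc 1 (T / 2)).filter fun k =>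
          fenwickParent i k < (p + 1) / 2 ∧ (p + 1) / 2 ≤ k)).image (2 * ·)) := by
      intro k
      simp only [Finset.mem_filter, Finset.mem_Icc, Finset.mem_insert, Finset.mem_image]
      simp only [fenwickParent]
      rintro ⟨hk, h1, h2⟩
      split_ifs at h1 with h
      · exact Or.inr ⟨k / 2, by omega, by omega⟩
      · left; omega
    calc _ ≤ _ := Finset.card_le_card hsub
      _ ≤ _ := Finset.card_insert_le _ _
      _ ≤ _ := Nat.add_le_add_right (Finset.card_image_le.trans (ih _ _ (by omega))) 1

/-- The discrete Laplace weight with parameter `a`. -/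
noncomputable def discreteLaplace (a : ℝ) (z : ℤ) : ℝ≥0∞ :=
  ENNReal.ofReal ((1 - Real.exp (-a)) / (1 + Real.exp (-a)) * Real.exp (-a * |(z : ℝ)|))

lemma hasSum_exp_neg_mul_abs {a l : ℝ} (h1 : l < a) (h2 : -a < l) :
    HasSum (fun z : ℤ => Real.exp (-a * |(z : ℝ)| + l * z))
      ((1 - Real.exp (l - a))⁻¹ + Real.exp (-l - a) * (1 - Real.exp (-l - a))⁻¹) := by
  have hpos := hasSum_geometric_of_lt_one (Real.exp_pos (l - a)).le
    (Real.exp_lt_one_iff.2 (by linarith))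
  have hneg := (hasSum_geometric_of_lt_one (Real.exp_pos (-l - a)).le
    (Real.exp_lt_one_iff.2 (by linarith))).mul_left (Real.exp (-l - a))
  refine HasSum.of_nat_of_neg_add_one ?_ ?_
  · refine Eq.mp (congrArg (HasSum · _) (funext fun n => ?_)) hpos
    rw [← Real.exp_nat_mul]
    simp only [Int.cast_natCast, Nat.abs_cast]
    ring_nf
  · refine Eq.mp (congrArg (HasSum · _) (funext fun n => ?_)) hneg
    rw [← Real.exp_nat_mul, ← Real.exp_add]
    have : |((-((n : ℤ) + 1) : ℤ) : ℝ)| = n + 1 := by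
      push_cast
      rw [abs_neg, abs_of_nonneg (by positivity)]
    rw [this]
    push_cast
    ring_nf

lemma tsum_discreteLaplace_mul_exp {a l : ℝ} (ha : 0 < a) (h1 : l < a) (h2 : -a < l) :
    ∑' z : ℤ, discreteLaplace a z * ENNReal.ofReal (Real.exp (l * z)) =
      ENNReal.ofReal ((1 - Real.exp (-a)) / (1 + Real.exp (-a)) *
        ((1 - Real.exp (l - a))⁻¹ + Real.exp (-l - a) * (1 - Real.exp (-l - a))⁻¹)) := by
  have hc : 0 ≤ (1 - Real.exp (-a)) / (1 + Real.exp (-a)) := by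
    have : Real.exp (-a) < 1 := Real.exp_lt_one_iff.2 (by linarith)
    exact div_nonneg (by linarith) (by positivity)
  have h := (hasSum_exp_neg_mul_abs h1 h2).mul_left ((1 - Real.exp (-a)) / (1 + Real.exp (-a)))
  rw [← h.tsum_eq, ENNReal.ofReal_tsum_of_nonneg (fun z => by positivity) h.summable]
  refine tsum_congr fun z => ?_
  rw [discreteLaplace, ← ENNReal.ofReal_mul (by positivity), mul_assoc, ← Real.exp_add]

lemma tsum_discreteLaplace {a : ℝ} (ha : 0 < a) : ∑' z : ℤ, discreteLaplace a z = 1 := by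
  have h := tsum_discreteLaplace_mul_exp ha ha (neg_lt_zero.2 ha)
  simp only [zero_mul, Real.exp_zero, ENNReal.ofReal_one, mul_one, zero_sub, neg_zero] at h
  rw [h, ← ENNReal.ofReal_one]
  congr 1
  have : Real.exp (-a) < 1 := Real.exp_lt_one_iff.2 (by linarith)
  have h3 : 1 - Real.exp (-a) ≠ 0 := by linarith
  field_simp

lemma tsum_discreteLaplace_mul_exp_half_le {a l : ℝ} (ha : 0 < a) (hl : |l| = a / 2) :
    ∑' z : ℤ, discreteLaplace a z * ENNReal.ofReal (Real.exp (l * z)) ≤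
      ENNReal.ofReal (4 / 3) := by
  have hl' : l = a / 2 ∨ l = -(a / 2) := eq_or_eq_neg_of_abs_eq hl
  rw [tsum_discreteLaplace_mul_exp ha (by rcases hl' with h | h <;> linarith)
    (by rcases hl' with h | h <;> linarith)]
  apply ENNReal.ofReal_le_ofReal
  set y := Real.exp (-(a / 2)) with hy
  have hy0 : 0 < y := Real.exp_pos _
  have hy1 : y < 1 := Real.exp_lt_one_iff.2 (by linarith)
  have e2 : Real.exp (-a) = y ^ 2 := by rw [hy, ← Real.exp_nat_mul]; push_cast; ring_nf
  have e3 : Real.exp (-(a / 2) - a) = y ^ 3 := by rw [hy, ← Real.exp_nat_mul]; push_cast; ring_nf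
  have e1 : Real.exp (a / 2 - a) = y := by rw [hy]; ring_nf
  have p1 : 1 - y ≠ 0 := by linarith
  have p3 : 1 - y ^ 3 = (1 - y) * (1 + y + y ^ 2) := by ring
  have key : (1 - y ^ 2) / (1 + y ^ 2) * ((1 - y)⁻¹ + y ^ 3 * (1 - y ^ 3)⁻¹) ≤ 4 / 3 := by
    have : (1 - y ^ 2) / (1 + y ^ 2) * ((1 - y)⁻¹ + y ^ 3 * (1 - y ^ 3)⁻¹) =
        (1 + y) ^ 2 / (1 + y + y ^ 2) := by
      rw [p3]
      field_simp
      ring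
    rw [this, div_le_div_iff₀ (by positivity) (by norm_num)]
    nlinarith [sq_nonneg (1 - y)]
  rcases hl' with rfl | rfl
  · rw [e2, e1, e3]; exact key
  · rw [neg_neg, e2, e1, e3]
    refine le_of_eq_of_le ?_ key
    rw [p3]
    field_simp
    ring

lemma discreteLaplace_le {a : ℝ} (ha : 0 < a) (z w : ℤ) :
    discreteLaplace a z ≤ ENNReal.ofReal (Real.exp (a * |((z - w : ℤ) : ℝ)|)) *
      discreteLaplace a w := by
  have hc : 0 ≤ (1 - Real.exp (-a)) / (1 + Real.exp (-a)) := by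
    have : Real.exp (-a) < 1 := Real.exp_lt_one_iff.2 (by linarith)
    exact div_nonneg (by linarith) (by positivity)
  rw [discreteLaplace, discreteLaplace, ← ENNReal.ofReal_mul (by positivity), mul_left_comm,
    ← Real.exp_add]
  gcongr
  have h := abs_sub_abs_le_abs_sub (w : ℝ) z
  rw [abs_sub_comm] at h
  push_cast
  nlinarith

/-- The one-based extension by zero of a vector indexed by `Fin t`. -/
def oneBased {t : ℕ} (η : Fin t → ℤ) (k : ℕ) : ℤ :=
  if h : 0 < k ∧ k ≤ t then η ⟨k - 1, by omega⟩ else 0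

lemma oneBased_zero {t : ℕ} (η : Fin t → ℤ) : oneBased η 0 = 0 := by simp [oneBased]

lemma oneBased_succ {t : ℕ} (η : Fin t → ℤ) (i : Fin t) : oneBased η (i + 1) = η i := by
  have : (i : ℕ) + 1 ≤ t := i.2
  simp [oneBased, this]

lemma oneBased_snoc_of_le {t k : ℕ} (η : Fin t → ℤ) (z : ℤ) (hk : k ≤ t) :
    oneBased (Fin.snoc η z : Fin (t + 1) → ℤ) k = oneBased η k := by
  rcases Nat.eq_zero_or_pos k with rfl | h
  · simp [oneBased_zero]
  · have h1 : k ≤ t + 1 := by omega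
    have h2 : k - 1 < t := by omega
    simp [oneBased, h, hk, h1, Fin.snoc, h2]

lemma oneBased_snoc_last {t : ℕ} (η : Fin t → ℤ) (z : ℤ) :
    oneBased (Fin.snoc η z : Fin (t + 1) → ℤ) (t + 1) = z := by
  simp [oneBased, Fin.snoc]

/-- The weight of `η` when its increments along the forest `par` are independent with weight `q`. -/
noncomputable def treeWeight (q : ℤ → ℝ≥0∞) (par : ℕ → ℕ) (t : ℕ) (η : Fin t → ℤ) : ℝ≥0∞ :=
  ∏ k ∈ Finset.Icc 1 t, q (oneBased η k - oneBased η (par k))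

lemma treeWeight_snoc {q : ℤ → ℝ≥0∞} {par : ℕ → ℕ} (hpar : ∀ k, 0 < k → par k < k)
    {t : ℕ} (η : Fin t → ℤ) (z : ℤ) :
    treeWeight q par (t + 1) (Fin.snoc η z) =
      treeWeight q par t η * q (z - oneBased η (par (t + 1))) := by
  rw [treeWeight, Finset.prod_Icc_succ_top (by omega), oneBased_snoc_last,
    oneBased_snoc_of_le _ _ (Nat.lt_succ_iff.1 (hpar _ t.succ_pos)), treeWeight]
  congr 1
  refine Finset.prod_congr rfl fun k hk => ?_
  have hk := Finset.mem_Icc.1 hk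
  have := hpar k hk.1
  rw [oneBased_snoc_of_le _ _ (by omega), oneBased_snoc_of_le _ _ (by omega)]

lemma tsum_fin_succ_eq_tsum_snoc {t : ℕ} (f : (Fin (t + 1) → ℤ) → ℝ≥0∞) :
    ∑' η, f η = ∑' η : Fin t → ℤ, ∑' z : ℤ, f (Fin.snoc η z) := by
  rw [← (Fin.snocEquiv fun _ : Fin (t + 1) => ℤ).tsum_eq, ENNReal.tsum_prod', ENNReal.tsum_comm]
  rfl

lemma tsum_treeWeight_mul_exp {q : ℤ → ℝ≥0∞} (hq : ∑' z, q z = 1) {par : ℕ → ℕ}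
    (hpar : ∀ k, 0 < k → par k < k) {depth : ℕ → ℕ} (h0 : depth 0 = 0)
    (hdepth : ∀ k, 0 < k → depth k = depth (par k) + 1) (l : ℝ) (t : ℕ) :
    ∀ k ≤ t, ∑' η, treeWeight q par t η * ENNReal.ofReal (Real.exp (l * oneBased η k)) =
      (∑' z, q z * ENNReal.ofReal (Real.exp (l * z))) ^ depth k := by
  induction t with
  | zero =>
    intro k hk
    obtain rfl : k = 0 := by omega
    simp [treeWeight, h0, oneBased_zero]
  | succ t ih =>
    intro k hk
    rw [tsum_fin_succ_eq_tsum_snoc]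
    simp only [treeWeight_snoc hpar]
    rcases Nat.lt_or_ge t k with hlt | hle
    · obtain rfl : k = t + 1 := by omega
      rw [hdepth _ t.succ_pos, pow_succ, ← ih _ (Nat.lt_succ_iff.1 (hpar _ t.succ_pos)),
        ← ENNReal.tsum_mul_right]
      refine tsum_congr fun η => ?_
      rw [← (Equiv.addRight (oneBased η (par (t + 1)))).tsum_eq, ← ENNReal.tsum_mul_left]
      refine tsum_congr fun z => ?_
      simp only [oneBased_snoc_last, Equiv.coe_addRight, add_sub_cancel_right]
      push_cast
      rw [mul_add, Real.exp_add, ENNReal.ofReal_mul (Real.exp_pos _).le]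
      ring
    · rw [← ih k hle]
      refine tsum_congr fun η => ?_
      simp only [oneBased_snoc_of_le _ _ hle]
      rw [ENNReal.tsum_mul_right, ENNReal.tsum_mul_left]
      have := (Equiv.subRight (oneBased η (par (t + 1)))).tsum_eq q
      simp only [Equiv.subRight_apply] at this
      rw [this, hq, mul_one]

lemma treeWeight_discreteLaplace_le {a : ℝ} (ha : 0 < a) {par : ℕ → ℕ}
    (hpar : ∀ k, 0 < k → par k < k) {t p N : ℕ}
    (hp : 0 < p) (hN : ((Finset.Icc 1 t).filter fun k => par k < p ∧ p ≤ k).card ≤ N)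
    {δ : ℤ} (hδ : |δ| ≤ 1) (η η' : Fin t → ℤ)
    (hη : ∀ j : Fin t, η j - η' j = if p ≤ j + 1 then δ else 0) :
    treeWeight (discreteLaplace a) par t η ≤
      ENNReal.ofReal (Real.exp (a * N)) * treeWeight (discreteLaplace a) par t η' := by
  have hext : ∀ k ≤ t, oneBased η k - oneBased η' k = if p ≤ k then δ else 0 := by
    intro k hk
    rcases Nat.eq_zero_or_pos k with rfl | h
    · simp [oneBased_zero, hp.ne']
    · have := hη ⟨k - 1, by omega⟩
      simp only [Nat.sub_add_cancel h] at this
      simpa [oneBased, h, hk] using this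
  have hterm : ∀ k ∈ Finset.Icc 1 t,
      discreteLaplace a (oneBased η k - oneBased η (par k)) ≤
        ENNReal.ofReal (Real.exp (a * if par k < p ∧ p ≤ k then 1 else 0)) *
          discreteLaplace a (oneBased η' k - oneBased η' (par k)) := by
    intro k hk
    obtain ⟨hk1, hkt⟩ := Finset.mem_Icc.1 hk
    have hlt := hpar k hk1
    refine (discreteLaplace_le ha _ (oneBased η' k - oneBased η' (par k))).trans ?_
    gcongr
    have h1 := hext k hkt
    have h2 := hext (par k) (by omega)
    have h3 : |(oneBased η k - oneBased η (par k)) - (oneBased η' k - oneBased η' (par k))| ≤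
        if par k < p ∧ p ≤ k then 1 else 0 := by
      rw [sub_sub_sub_comm, h1, h2]
      split_ifs <;> first | omega | simp [hδ]
    exact_mod_cast h3
  refine (Finset.prod_le_prod' hterm).trans ?_
  rw [Finset.prod_mul_distrib, ← ENNReal.ofReal_prod_of_nonneg fun _ _ => (Real.exp_pos _).le,
    ← Real.exp_sum, ← Finset.mul_sum, Finset.sum_boole, treeWeight]
  gcongr

/-- The distribution of prefix-sum noise whose increments along `fenwickParent i` are independent
discrete Laplace variables. -/
noncomputable def fenwickNoise (i : ℕ) {a : ℝ} (ha : 0 < a) (t : ℕ) : PMF (Fin t → ℤ) :=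
  ⟨treeWeight (discreteLaplace a) (fenwickParent i) t, by
    have h := tsum_treeWeight_mul_exp (tsum_discreteLaplace ha) (fenwickParent_lt i)
      (fenwickDepth_zero i) (fenwickDepth_eq i) 0 t 0 t.zero_le
    simp only [zero_mul, Real.exp_zero, ENNReal.ofReal_one, mul_one, fenwickDepth_zero,
      pow_zero] at h
    exact h ▸ ENNReal.summable.hasSum⟩

lemma fenwickNoise_privacy (i : ℕ) {a : ℝ} (ha : 0 < a) (t : ℕ) [NeZero t] (x x' : Fin t → ℤ)
    (hx : ∀ i, x i = 0 ∨ x i = 1) (hx' : ∀ i, x' i = 0 ∨ x' i = 1)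
    (hxx' : ∀ i j, x i ≠ x' i → x j ≠ x' j → i = j) (v : Fin t → ℤ) :
    (fenwickNoise i ha t).toOuterMeasure {η | ∀ j, (∑ i ∈ Finset.Iic j, x i) + η j = v j} ≤
      ENNReal.ofReal (Real.exp (a * (i + 1))) * (fenwickNoise i ha t).toOuterMeasure
        {η | ∀ j, (∑ i ∈ Finset.Iic j, x' i) + η j = v j} := by
  have hset : ∀ y : Fin t → ℤ, {η : Fin t → ℤ | ∀ j, (∑ i ∈ Finset.Iic j, y i) + η j = v j} =
      {fun j => v j - ∑ i ∈ Finset.Iic j, y i} := by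
    intro y
    ext η
    simp only [Set.mem_ofPred_eq, Set.mem_singleton_iff, funext_iff, eq_sub_iff_add_eq']
  obtain ⟨m, hm⟩ : ∃ m, ∀ j, j ≠ m → x j = x' j := by
    by_cases h : ∃ m, x m ≠ x' m
    · obtain ⟨m, hm⟩ := h
      exact ⟨m, fun j hj => by_contra fun hne => hj (hxx' j m hne hm)⟩
    · push Not at h
      exact ⟨0, fun j _ => h j⟩
  rw [hset, hset, PMF.toOuterMeasure_apply_singleton, PMF.toOuterMeasure_apply_singleton]
  have h := treeWeight_discreteLaplace_le ha (fenwickParent_lt i) (t := t) m.val.succ_pos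
    (card_fenwickParent_lt_le i t (m + 1) m.val.succ_pos) (δ := x' m - x m)
    (by rcases hx m with h | h <;> rcases hx' m with h' | h' <;> simp [h, h'])
    (fun j => v j - ∑ i ∈ Finset.Iic j, x i) (fun j => v j - ∑ i ∈ Finset.Iic j, x' i) (by
      intro j
      have hsum : ∑ i ∈ Finset.Iic j, (x' i - x i) =
          ∑ i ∈ Finset.Iic j, if m = i then x' m - x m else 0 := by
        refine Finset.sum_congr rfl fun i _ => ?_
        split_ifs with him
        · rw [him]
        · rw [hm i (Ne.symm him), sub_self]
      rw [Finset.sum_ite_eq, Finset.sum_sub_distrib] at hsum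
      simp only [Finset.mem_Iic, Fin.le_def] at hsum
      simp only [sub_sub_sub_cancel_left, hsum, Nat.succ_eq_add_one, add_le_add_iff_right])
  push_cast at h
  exact h

lemma fenwickNoise_mgf_le (i : ℕ) {a l : ℝ} (ha : 0 < a) (hl : |l| = a / 2) {t : ℕ}
    (ht : t < 2 ^ (i + 2)) (j : Fin t) :
    ∑' η, fenwickNoise i ha t η * ENNReal.ofReal (Real.exp (l * η j)) ≤
      ENNReal.ofReal √(2 * t) := by
  have h := tsum_treeWeight_mul_exp (tsum_discreteLaplace ha) (fenwickParent_lt i)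
    (fenwickDepth_zero i) (fenwickDepth_eq i) l t (j + 1) j.2
  simp only [oneBased_succ] at h
  refine h.trans_le ((pow_le_pow_left' (tsum_discreteLaplace_mul_exp_half_le ha hl) _).trans ?_)
  rw [← ENNReal.ofReal_pow (by norm_num)]
  apply ENNReal.ofReal_le_ofReal
  apply Real.le_sqrt_of_sq_le
  have hj : j.val + 1 ≤ t := j.2
  have h2 := pow_fenwickDepth_le i (j + 1) j.val.succ_pos (by omega)
  rw [← pow_mul, mul_comm, pow_mul]
  have hj' : ((j.val + 1 : ℕ) : ℝ) ≤ t := by exact_mod_cast hj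
  norm_num at h2 hj' ⊢
  linarith

lemma fenwickNoise_tail_le (i : ℕ) {a : ℝ} (ha : 0 < a) {t : ℕ} (ht : t < 2 ^ (i + 2)) (T : ℝ) :
    (fenwickNoise i ha t).toOuterMeasure {η | ∃ j, T ≤ |(η j : ℝ)|} ≤
      ENNReal.ofReal (2 * t * √(2 * t) * Real.exp (-(a / 2 * T))) := by
  have hpt : ∀ η : Fin t → ℤ,
      Set.indicator {η : Fin t → ℤ | ∃ j, T ≤ |(η j : ℝ)|} (fenwickNoise i ha t) η ≤
        ∑ j, ENNReal.ofReal (Real.exp (-(a / 2 * T))) *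
          (fenwickNoise i ha t η * ENNReal.ofReal (Real.exp (a / 2 * η j)) +
            fenwickNoise i ha t η * ENNReal.ofReal (Real.exp (-(a / 2) * η j))) := by
    intro η
    refine Set.indicator_apply_le' ?_ fun _ => zero_le
    rintro ⟨j, hj⟩
    refine le_trans ?_ (Finset.single_le_sum (fun _ _ => zero_le) (Finset.mem_univ j))
    rw [← mul_add, mul_left_comm, ← ENNReal.ofReal_add (Real.exp_pos _).le (Real.exp_pos _).le,
      ← ENNReal.ofReal_mul (Real.exp_pos _).le]
    refine le_mul_of_one_le_right' ?_
    rw [ENNReal.one_le_ofReal, mul_add, ← Real.exp_add, ← Real.exp_add]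
    have p1 := Real.exp_pos (-(a / 2 * T) + a / 2 * η j)
    have p2 := Real.exp_pos (-(a / 2 * T) + -(a / 2) * η j)
    rcases le_abs.1 hj with h | h
    · have := Real.one_le_exp (x := -(a / 2 * T) + a / 2 * η j) (by nlinarith)
      linarith
    · have := Real.one_le_exp (x := -(a / 2 * T) + -(a / 2) * η j) (by nlinarith)
      linarith
  rw [PMF.toOuterMeasure_apply]
  refine (ENNReal.tsum_le_tsum hpt).trans ?_
  rw [Summable.tsum_finsetSum fun _ _ => ENNReal.summable]
  have hl1 : |a / 2| = a / 2 := abs_of_pos (by linarith)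
  have hl2 : |-(a / 2)| = a / 2 := by rw [abs_neg, hl1]
  have hj : ∀ j ∈ (Finset.univ : Finset (Fin t)),
      ∑' η : Fin t → ℤ, ENNReal.ofReal (Real.exp (-(a / 2 * T))) *
          (fenwickNoise i ha t η * ENNReal.ofReal (Real.exp (a / 2 * η j)) +
            fenwickNoise i ha t η * ENNReal.ofReal (Real.exp (-(a / 2) * η j))) ≤
        ENNReal.ofReal (Real.exp (-(a / 2 * T)) * (√(2 * t) + √(2 * t))) := by
    intro j _
    rw [ENNReal.tsum_mul_left, ENNReal.tsum_add, ENNReal.ofReal_mul (Real.exp_pos _).le,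
      ENNReal.ofReal_add (Real.sqrt_nonneg _) (Real.sqrt_nonneg _)]
    gcongr
    · exact fenwickNoise_mgf_le i ha hl1 ht j
    · exact fenwickNoise_mgf_le i ha hl2 ht j
  refine (Finset.sum_le_card_nsmul _ _ _ hj).trans_eq ?_
  rw [Finset.card_univ, Fintype.card_fin, ← ENNReal.ofReal_nsmul, nsmul_eq_mul]
  congr 1
  ring

/-- Continual-counting (binary mechanism) noise guarantee: there is a distribution
`CC_ε(t)` on `ℤ^t` such that (1) for any two 0/1-vectors `x, x'` differing in at most
one coordinate, with prefix-sum vectors `s, s'`, and any `v`,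
`Pr[s + η = v] ≤ e^ε · Pr[s' + η = v]`, and (2) for every `β ∈ (0,1)`,
`Pr[‖η‖_∞ ≥ (3/ε)·log₂(t)·ln(2t/β)] ≤ β`. -/
theorem continual_counting_noise_exists
    (ε : ℝ) (hε : 0 < ε) (t : ℕ) (ht : 2 ≤ t) :
    ∃ μ : PMF (Fin t → ℤ),
      (∀ x x' : Fin t → ℤ,
        (∀ i, x i = 0 ∨ x i = 1) → (∀ i, x' i = 0 ∨ x' i = 1) →
        (∀ i j, x i ≠ x' i → x j ≠ x' j → i = j) →
        ∀ v : Fin t → ℤ,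
          μ.toOuterMeasure {η | ∀ j, (∑ i ∈ Finset.Iic j, x i) + η j = v j}
            ≤ ENNReal.ofReal (Real.exp ε) *
              μ.toOuterMeasure {η | ∀ j, (∑ i ∈ Finset.Iic j, x' i) + η j = v j}) ∧
      (∀ β : ℝ, 0 < β → β < 1 →
        μ.toOuterMeasure
            {η | ∃ i, (3 / ε) * Real.logb 2 t * Real.log (2 * t / β) ≤ |(η i : ℝ)|}
          ≤ ENNReal.ofReal β) := by
  have hlog1 : 1 ≤ Nat.log 2 t := Nat.log_pos one_lt_two ht
  obtain ⟨i, hi⟩ : ∃ i, Nat.log 2 t = i + 1 := ⟨_, (Nat.sub_add_cancel hlog1).symm⟩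
  have hti : t < 2 ^ (i + 2) := by
    have := Nat.lt_pow_succ_log_self one_lt_two t
    rwa [hi] at this
  have hlog : (i + 1 : ℝ) ≤ Real.logb 2 t := by
    have := Real.natLog_le_logb t 2
    rw [hi] at this
    exact_mod_cast this
  have hi0 : (0 : ℝ) < i + 1 := by positivity
  have ha : 0 < ε / (i + 1) := div_pos hε hi0
  have : NeZero t := ⟨by omega⟩
  refine ⟨fenwickNoise i ha t, fun x x' hx hx' hxx' v => ?_, fun β hβ hβ1 => ?_⟩
  · have h := fenwickNoise_privacy i ha t x x' hx hx' hxx' v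
    rwa [div_mul_cancel₀ _ hi0.ne'] at h
  · refine (fenwickNoise_tail_le i ha hti _).trans (ENNReal.ofReal_le_ofReal ?_)
    have ht0 : (0 : ℝ) < 2 * t := by positivity
    have ht1 : (2 : ℝ) ≤ t := by exact_mod_cast ht
    have hX : 0 < 2 * t / β := by positivity
    have hX1 : 1 ≤ 2 * t / β := by rw [one_le_div hβ]; linarith
    have hL : 0 ≤ Real.log (2 * t / β) := Real.log_nonneg hX1
    have hexp : Real.exp (-(ε / (i + 1) / 2 *
        ((3 / ε) * Real.logb 2 t * Real.log (2 * t / β)))) ≤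
          ((2 * t / β) * √(2 * t / β))⁻¹ := by
      have h1 : (2 * t / β) * √(2 * t / β) = Real.exp (3 / 2 * Real.log (2 * t / β)) := by
        rw [show 3 / 2 * Real.log (2 * t / β) =
          Real.log (2 * t / β) + Real.log (2 * t / β) / 2 by ring, Real.exp_add,
          Real.exp_log hX, ← Real.log_sqrt hX.le, Real.exp_log (Real.sqrt_pos.2 hX)]
      rw [h1, ← Real.exp_neg, Real.exp_le_exp, neg_le_neg_iff]
      have h2 : ε / (i + 1) / 2 * ((3 / ε) * Real.logb 2 t * Real.log (2 * t / β)) =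
          3 / 2 * (Real.logb 2 t / (i + 1)) * Real.log (2 * t / β) := by
        field_simp
      have h3 : 1 ≤ Real.logb 2 t / (i + 1) := by rwa [one_le_div hi0]
      rw [h2]
      nlinarith
    calc _ ≤ 2 * t * √(2 * t) * ((2 * t / β) * √(2 * t / β))⁻¹ := by gcongr
      _ = β * √β := by
        rw [Real.sqrt_div ht0.le]
        have := Real.sqrt_pos.2 ht0
        have := Real.sqrt_pos.2 hβ
        field_simp
      _ ≤ β := mul_le_of_le_one_right hβ.le (Real.sqrt_le_one.2 hβ1.le)
end

section
/- Under the SlicingEM setup, for every fixed adversarial noise vector η^A ∈ {0,…,w}^m, the mechanism M_{η^A}, viewed as a map from datasets of n distinct points of D to the joint distribution of the outputs (v_1,…,v_m), is (ε, δ·e^ε)-differentially private with respect to substitution of a single element. -/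
open scoped ENNReal

/-- Unnormalized weight of the quantile exponential mechanism:
`exp(−(ε/2)·|#{x ∈ S : x ≤ z} − ⌊q·|S|⌋|)`. -/
noncomputable def EMweight (S : Finset ℤ) (q ε : ℝ) (z : ℤ) : ℝ :=
  Real.exp (-(ε / 2) * |((S.filter fun x => x ≤ z).card : ℝ) - (⌊q * (S.card : ℝ)⌋ : ℝ)|)

/-- Probability that the quantile exponential mechanism `EM(S, q, ε)` on the domain
`D = {0,…,d}` outputs `z`. -/
noncomputable def EMmass (d : ℕ) (S : Finset ℤ) (q ε : ℝ) (z : ℤ) : ℝ :=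
  if z ∈ Finset.Icc (0 : ℤ) (d : ℤ) then
    EMweight S q ε z / ∑ z' ∈ Finset.Icc (0 : ℤ) (d : ℤ), EMweight S q ε z'
  else 0

/-- `X_sort[c : c']`: the sub-dataset of elements of `X` whose 1-based ranks in the
sorted order of `X` lie in `{c, …, c'}` (the rank of `x` is `#{y ∈ X : y ≤ x}`). -/
def sortSlice (X : Finset ℤ) (c c' : ℤ) : Finset ℤ :=
  X.filter fun x =>
    c ≤ ((X.filter fun y => y ≤ x).card : ℤ) ∧ ((X.filter fun y => y ≤ x).card : ℤ) ≤ c'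

/-- `ContVec m` is the set of 0/1-vectors that are 1 exactly on a nonempty contiguous
block of indices `{s, …, t}`. -/
def ContVec (m : ℕ) (e : Fin m → ℤ) : Prop :=
  ∃ s t : Fin m, s ≤ t ∧ ∀ i, e i = if s ≤ i ∧ i ≤ t then 1 else 0

/-- `μ` satisfies the CC property with parameter `ε'`: for every `v` and `e ∈ ContVec m`,
`Pr[η = v] ≤ e^{ε'}·Pr[e+η = v]` and `Pr[e+η = v] ≤ e^{ε'}·Pr[η = v]`. -/
def HasCCProperty {m : ℕ} (μ : PMF (Fin m → ℤ)) (ε' : ℝ) : Prop :=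
  ∀ v e : Fin m → ℤ, ContVec m e →
    μ v ≤ ENNReal.ofReal (Real.exp ε') * μ (fun i => v i - e i) ∧
    μ (fun i => v i - e i) ≤ ENNReal.ofReal (Real.exp ε') * μ v

/-- Coordinatewise truncation (clamping) to `[−⌊w/2⌋, ⌊w/2⌋]`. -/
noncomputable def clampW {m : ℕ} (w : ℤ) (η : Fin m → ℤ) : Fin m → ℤ :=
  fun i => max (-⌊(w : ℝ) / 2⌋) (min ⌊(w : ℝ) / 2⌋ (η i))

/-- Output probability mass of the SlicingEM mechanism `M_{η^A}` on dataset `X`: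
sample `η̃ ∼ μbar`, set `Δ_i = ⌊w/2⌋ + η̃_i − η^A_i`, and output, independently for
each `i`, `v_i = EM(X_sort[⌊n·q_i⌋ − h + Δ_i : ⌊n·q_i⌋ + h + Δ_i], 1/2, ε/6)`. -/
noncomputable def slicingEMmass (d n m : ℕ) (ε : ℝ) (h w : ℤ) (q : Fin m → ℝ)
    (μbar : PMF (Fin m → ℤ)) (ηA : Fin m → ℤ) (X : Finset ℤ)
    (v : Fin m → ℤ) : ℝ≥0∞ :=
  ∑' η : Fin m → ℤ, μbar η *
    ∏ i : Fin m, ENNReal.ofReal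
      (EMmass d
        (sortSlice X (⌊(n : ℝ) * q i⌋ - h + (⌊(w : ℝ) / 2⌋ + η i - ηA i))
                     (⌊(n : ℝ) * q i⌋ + h + (⌊(w : ℝ) / 2⌋ + η i - ηA i)))
        (1 / 2) (ε / 6) (v i))

/-- Number of elements of `S` that are at most `z`. -/
def countLE (S : Finset ℤ) (z : ℤ) : ℕ := (S.filter fun x => x ≤ z).card

lemma countLE_mono (S : Finset ℤ) : Monotone (countLE S) := fun _ _ h =>
  Finset.card_le_card fun x hx => by
    simp only [Finset.mem_filter] at hx ⊢
    exact ⟨hx.1, hx.2.trans h⟩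

lemma countLE_lt_of_lt_mem {S : Finset ℤ} {z x : ℤ} (hx : x ∈ S) (hzx : z < x) :
    countLE S z < countLE S x := by
  refine Finset.card_lt_card (Finset.ssubset_iff_of_subset ?_ |>.2 ⟨x, ?_, ?_⟩)
  · intro u hu
    simp only [Finset.mem_filter] at hu ⊢
    exact ⟨hu.1, hu.2.trans hzx.le⟩
  · simp [hx]
  · simp [hzx]

lemma countLE_injOn (S : Finset ℤ) : Set.InjOn (countLE S) (S : Set ℤ) := by
  intro x hx y hy hxy
  rcases lt_trichotomy x y with h | h | h
  · exact absurd hxy (countLE_lt_of_lt_mem hy h).ne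
  · exact h
  · exact absurd hxy (countLE_lt_of_lt_mem hx h).ne'

lemma image_countLE_filter (S : Finset ℤ) (z : ℤ) :
    (S.filter fun x => x ≤ z).image (countLE S) = Finset.Icc 1 (countLE S z) := by
  apply Finset.eq_of_subset_of_card_le
  · intro r hr
    simp only [Finset.mem_image, Finset.mem_filter] at hr
    obtain ⟨x, ⟨hx, hxz⟩, rfl⟩ := hr
    refine Finset.mem_Icc.2 ⟨Finset.card_pos.2 ⟨x, by simp [hx]⟩, countLE_mono S hxz⟩
  · rw [Finset.card_image_of_injOn ((countLE_injOn S).mono fun x hx => (Finset.mem_filter.1 hx).1)]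
    simp [countLE]

lemma countLE_sortSlice (X : Finset ℤ) (c c' z : ℤ) :
    (countLE (sortSlice X c c') z : ℤ) =
      max 0 (min c' (countLE X z : ℤ) + 1 - max c 1) := by
  have h1 : ((sortSlice X c c').filter fun x => x ≤ z).image (fun x => (countLE X x : ℤ)) =
      Finset.Icc (max c 1) (min c' (countLE X z : ℤ)) := by
    ext r
    simp only [Finset.mem_image, Finset.mem_filter, sortSlice, Finset.mem_Icc]
    constructor
    · rintro ⟨x, ⟨⟨hx, hc, hc'⟩, hxz⟩, rfl⟩
      have hm : countLE X x ∈ Finset.Icc 1 (countLE X z) := by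
        rw [← image_countLE_filter]
        exact Finset.mem_image_of_mem _ (by simp [hx, hxz])
      rw [Finset.mem_Icc] at hm
      change c ≤ (countLE X x : ℤ) at hc
      change (countLE X x : ℤ) ≤ c' at hc'
      omega
    · intro hr
      have hm : r.toNat ∈ Finset.Icc 1 (countLE X z) := by
        rw [Finset.mem_Icc]; omega
      rw [← image_countLE_filter, Finset.mem_image] at hm
      obtain ⟨x, hx, hxr⟩ := hm
      rw [Finset.mem_filter] at hx
      have hxr' : (countLE X x : ℤ) = r := by omega
      refine ⟨x, ⟨⟨hx.1, ?_, ?_⟩, hx.2⟩, hxr'⟩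
      · change c ≤ (countLE X x : ℤ); omega
      · change (countLE X x : ℤ) ≤ c'; omega
  have h2 := congrArg Finset.card h1
  rw [Finset.card_image_of_injOn, Int.card_Icc] at h2
  · unfold countLE at h2 ⊢
    omega
  · intro x hx y hy hxy
    simp only [sortSlice, Finset.coe_filter, Finset.mem_filter, Set.mem_ofPred_eq] at hx hy
    exact countLE_injOn X hx.1.1 hy.1.1 (Nat.cast_injective (R := ℤ) hxy)

lemma countLE_eq_card {S : Finset ℤ} {z : ℤ} (h : ∀ x ∈ S, x ≤ z) : countLE S z = S.card := by
  rw [countLE, Finset.filter_true_of_mem h]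

/-- Removing an element of rank `a` and inserting a larger one of final rank `b` changes the
counting function from `F` to `F'` in the way recorded here. -/
def SubstPattern (F F' : ℤ → ℕ) (a b : ℤ) : Prop :=
  1 ≤ a ∧ a ≤ b ∧ ∀ z, ((F z : ℤ) = F' z ∧ (F z : ℤ) < a) ∨
    ((F z : ℤ) = F' z + 1 ∧ a ≤ F z ∧ (F z : ℤ) ≤ b) ∨ ((F z : ℤ) = F' z ∧ b ≤ F z)

lemma countLE_insert {Z : Finset ℤ} {x : ℤ} (hx : x ∉ Z) (z : ℤ) :
    countLE (insert x Z) z = countLE Z z + if x ≤ z then 1 else 0 := by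
  unfold countLE
  rw [Finset.filter_insert]
  split_ifs with h
  · rw [Finset.card_insert_of_notMem (by simp [hx])]
  · simp

lemma substPattern_insert {Z : Finset ℤ} {x y : ℤ} (hx : x ∉ Z) (hy : y ∉ Z) (hxy : x < y) :
    SubstPattern (countLE (insert x Z)) (countLE (insert y Z))
      (countLE (insert x Z) x) (countLE (insert y Z) y) := by
  have hxm : x ∈ insert x Z := Finset.mem_insert_self _ _
  have hym : y ∈ insert y Z := Finset.mem_insert_self _ _
  have key : ∀ z, (((countLE (insert x Z) z : ℕ) : ℤ) = countLE (insert y Z) z ∧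
        ((countLE (insert x Z) z : ℕ) : ℤ) < countLE (insert x Z) x) ∨
      (((countLE (insert x Z) z : ℕ) : ℤ) = countLE (insert y Z) z + 1 ∧
        (countLE (insert x Z) x : ℤ) ≤ countLE (insert x Z) z ∧
        ((countLE (insert x Z) z : ℕ) : ℤ) ≤ countLE (insert y Z) y) ∨
      (((countLE (insert x Z) z : ℕ) : ℤ) = countLE (insert y Z) z ∧
        (countLE (insert y Z) y : ℤ) ≤ countLE (insert x Z) z) := by
    intro z
    have ex := countLE_insert hx z
    have ey := countLE_insert hy z
    rcases lt_or_ge z x with h | h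
    · left
      have := countLE_lt_of_lt_mem hxm h
      rw [if_neg (by omega)] at ex ey
      omega
    · right
      have h1 := countLE_mono (insert x Z) h
      rw [if_pos h] at ex
      rcases lt_or_ge z y with h' | h'
      · left
        have := countLE_lt_of_lt_mem hym h'
        rw [if_neg (by omega)] at ey
        omega
      · right
        have := countLE_mono (insert y Z) h'
        rw [if_pos h'] at ey
        omega
  have hpos : 0 < countLE (insert x Z) x := Finset.card_pos.2 ⟨x, by simp⟩
  refine ⟨by omega, ?_, key⟩
  have e1 := countLE_insert hx x
  have e2 := countLE_insert hy x
  have := countLE_lt_of_lt_mem hym hxy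
  simp only [le_refl, if_true] at e1
  rw [if_neg (by omega)] at e2
  omega

/-- The contiguous shift and the at most two exceptional blocks produced by a substitution. -/
lemma exists_contVec {m : ℕ} {a b : ℤ} (hab : a ≤ b) (lo hi : Fin m → ℤ)
    (hle : ∀ i, lo i ≤ hi i) (hsep : ∀ i j, i < j → hi i < lo j) :
    ∃ (e : Fin m → ℤ) (T : Finset (Fin m)), T.card ≤ 2 ∧ (e = 0 ∨ ContVec m e) ∧
      ∀ i, (i ∈ T ∧ e i = 0) ∨ (i ∉ T ∧ e i = 0 ∧ (hi i < a ∨ b < lo i)) ∨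
        (i ∉ T ∧ e i = 1 ∧ a < lo i ∧ hi i < b) := by
  classical
  have hone : ∀ p : ℤ, (Finset.univ.filter fun i => lo i ≤ p ∧ p ≤ hi i).card ≤ 1 := by
    intro p
    refine Finset.card_le_one.2 fun i hi' j hj' => ?_
    simp only [Finset.mem_filter, Finset.mem_univ, true_and] at hi' hj'
    rcases lt_trichotomy i j with h | h | h
    · have := hsep i j h; omega
    · exact h
    · have := hsep j i h; omega
  refine ⟨fun i => if a < lo i ∧ hi i < b then 1 else 0,
    (Finset.univ.filter fun i => lo i ≤ a ∧ a ≤ hi i) ∪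
      (Finset.univ.filter fun i => lo i ≤ b ∧ b ≤ hi i), ?_, ?_, ?_⟩
  · refine (Finset.card_union_le _ _).trans ?_
    have := hone a
    have := hone b
    omega
  · set J := Finset.univ.filter fun i => a < lo i ∧ hi i < b with hJ
    rcases J.eq_empty_or_nonempty with h | h
    · left
      funext i
      have : i ∉ J := by simp [h]
      simp only [hJ, Finset.mem_filter, Finset.mem_univ, true_and] at this
      simp [this]
    · right
      have hs := J.min'_mem h
      have ht := J.max'_mem h
      refine ⟨J.min' h, J.max' h, J.min'_le_max' h, fun i => ?_⟩
      have hiff : (a < lo i ∧ hi i < b) ↔ (J.min' h ≤ i ∧ i ≤ J.max' h) := by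
        constructor
        · intro hi'
          have : i ∈ J := by simp [hJ, hi']
          exact ⟨J.min'_le i this, J.le_max' i this⟩
        · rintro ⟨h1, h2⟩
          replace hs := (Finset.mem_filter.1 hs).2
          replace ht := (Finset.mem_filter.1 ht).2
          constructor
          · rcases h1.eq_or_lt with h1 | h1
            · rw [← h1]; exact hs.1
            · have := hsep _ _ h1
              have := hle (J.min' h)
              omega
          · rcases h2.eq_or_lt with h2 | h2
            · rw [h2]; exact ht.2
            · have := hsep _ _ h2
              have := hle (J.max' h)
              omega
      simp only [hiff]
  · intro i
    simp only [Finset.mem_union, Finset.mem_filter, Finset.mem_univ, true_and]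
    have := hle i
    split_ifs <;> omega

lemma EMweight_eq (S : Finset ℤ) (q ε : ℝ) (z : ℤ) :
    EMweight S q ε z =
      Real.exp (-(ε / 2) * |(countLE S z : ℝ) - (⌊q * (S.card : ℝ)⌋ : ℝ)|) := rfl

lemma EMweight_pos (S : Finset ℤ) (q ε : ℝ) (z : ℤ) : 0 < EMweight S q ε z := Real.exp_pos _

lemma EMweight_le {S S' : Finset ℤ} {q ε k : ℝ} (hε : 0 ≤ ε) {z : ℤ}
    (hz : |(countLE S z : ℝ) - countLE S' z| ≤ k) (hcard : S.card = S'.card) :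
    EMweight S q ε z ≤ Real.exp (ε / 2 * k) * EMweight S' q ε z := by
  rw [EMweight_eq, EMweight_eq, ← Real.exp_add, Real.exp_le_exp, hcard]
  have h1 := abs_sub_abs_le_abs_sub ((countLE S' z : ℝ) - (⌊q * (S'.card : ℝ)⌋ : ℝ))
    ((countLE S z : ℝ) - (⌊q * (S'.card : ℝ)⌋ : ℝ))
  rw [sub_sub_sub_cancel_right, abs_sub_comm (countLE S' z : ℝ) (countLE S z : ℝ)] at h1
  nlinarith

lemma EMmass_nonneg (d : ℕ) (S : Finset ℤ) (q ε : ℝ) (z : ℤ) : 0 ≤ EMmass d S q ε z := by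
  unfold EMmass
  split_ifs
  · exact div_nonneg (EMweight_pos _ _ _ _).le
      (Finset.sum_nonneg fun _ _ => (EMweight_pos _ _ _ _).le)
  · rfl

lemma EMmass_le (d : ℕ) {S S' : Finset ℤ} {q ε k : ℝ} (hε : 0 ≤ ε)
    (hz : ∀ z, |(countLE S z : ℝ) - countLE S' z| ≤ k) (hcard : S.card = S'.card) (z : ℤ) :
    EMmass d S q ε z ≤ Real.exp (ε * k) * EMmass d S' q ε z := by
  unfold EMmass
  split_ifs with hmem
  · have hpos : ∀ U : Finset ℤ, 0 < ∑ z' ∈ Finset.Icc (0 : ℤ) (d : ℤ), EMweight U q ε z' :=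
      fun U => Finset.sum_pos (fun _ _ => EMweight_pos _ _ _ _) ⟨z, hmem⟩
    have hsum : ∑ z' ∈ Finset.Icc (0 : ℤ) (d : ℤ), EMweight S' q ε z' ≤
        Real.exp (ε / 2 * k) * ∑ z' ∈ Finset.Icc (0 : ℤ) (d : ℤ), EMweight S q ε z' := by
      rw [Finset.mul_sum]
      refine Finset.sum_le_sum fun u _ => EMweight_le hε ?_ hcard.symm
      rw [abs_sub_comm]
      exact hz u
    have hw := EMweight_le (q := q) hε (hz z) hcard
    rw [← mul_div_assoc, div_le_div_iff₀ (hpos S) (hpos S')]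
    have hsplit : Real.exp (ε * k) = Real.exp (ε / 2 * k) * Real.exp (ε / 2 * k) := by
      rw [← Real.exp_add]; ring_nf
    rw [hsplit]
    calc EMweight S q ε z * ∑ z' ∈ Finset.Icc (0 : ℤ) (d : ℤ), EMweight S' q ε z'
        ≤ (Real.exp (ε / 2 * k) * EMweight S' q ε z) * (Real.exp (ε / 2 * k) *
            ∑ z' ∈ Finset.Icc (0 : ℤ) (d : ℤ), EMweight S q ε z') :=
          mul_le_mul hw hsum (hpos S').le
            (mul_nonneg (Real.exp_pos _).le (EMweight_pos _ _ _ _).le)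
      _ = _ := by ring
  · simp

lemma sum_EMmass (d : ℕ) (S : Finset ℤ) (q ε : ℝ) :
    ∑ z ∈ Finset.Icc (0 : ℤ) (d : ℤ), EMmass d S q ε z = 1 := by
  have hpos : 0 < ∑ z' ∈ Finset.Icc (0 : ℤ) (d : ℤ), EMweight S q ε z' :=
    Finset.sum_pos (fun _ _ => EMweight_pos _ _ _ _) ⟨0, by simp⟩
  rw [Finset.sum_congr rfl (g := fun z => EMweight S q ε z /
    ∑ z' ∈ Finset.Icc (0 : ℤ) (d : ℤ), EMweight S q ε z')
    (fun z hz => by rw [EMmass, if_pos hz]), ← Finset.sum_div, div_self hpos.ne']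

lemma tsum_prod_EMmass {m : ℕ} (d : ℕ) (S : Fin m → Finset ℤ) (q ε : ℝ) :
    ∑' v : Fin m → ℤ, ∏ i, ENNReal.ofReal (EMmass d (S i) q ε (v i)) = 1 := by
  classical
  rw [tsum_eq_sum (s := Fintype.piFinset fun _ => Finset.Icc (0 : ℤ) (d : ℤ)),
    ← Finset.prod_univ_sum (fun _ : Fin m => Finset.Icc (0 : ℤ) (d : ℤ))
      (fun i z => ENNReal.ofReal (EMmass d (S i) q ε z))]
  · refine Finset.prod_eq_one fun i _ => ?_
    rw [← ENNReal.ofReal_sum_of_nonneg fun z _ => EMmass_nonneg _ _ _ _ _, sum_EMmass,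
      ENNReal.ofReal_one]
  · intro v hv
    simp only [Fintype.mem_piFinset, not_forall] at hv
    obtain ⟨i, hi⟩ := hv
    refine Finset.prod_eq_zero (Finset.mem_univ i) ?_
    rw [EMmass, if_neg hi, ENNReal.ofReal_zero]

lemma PMF.tsum_map_mul {α β : Type*} (p : PMF α) (g : α → β) (f : β → ℝ≥0∞) :
    ∑' b, p.map g b * f b = ∑' a, p a * f (g a) := by
  classical
  simp only [PMF.map_apply, ← ENNReal.tsum_mul_right]
  rw [ENNReal.tsum_comm]
  refine tsum_congr fun a => ?_
  rw [tsum_eq_single (g a)]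
  · simp
  · intro b hb
    simp [hb]

/-- A substitution changes the exponential mechanism on each slice by a bounded factor, after
shifting the slices by a suitable contiguous vector or its negative. -/
lemma exists_slice_coupling {m d : ℕ} {X X' : Finset ℤ} {ε : ℝ} (hε : 0 ≤ ε) (quant : ℝ)
    (hcard : X.card = X'.card)
    (hX : (X : Set ℤ) ⊆ Set.Icc (0 : ℤ) (d : ℤ)) (hX' : (X' : Set ℤ) ⊆ Set.Icc (0 : ℤ) (d : ℤ))
    (h1 : (X \ X').card = 1) (h2 : (X' \ X).card = 1) (lo hi : Fin m → ℤ)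
    (hle : ∀ i, lo i ≤ hi i) (hsep : ∀ i j, i < j → hi i + 1 < lo j) :
    ∃ (s e : Fin m → ℤ) (T : Finset (Fin m)), T.card ≤ 2 ∧ (e = 0 ∨ ContVec m e) ∧
      (s = e ∨ s = -e) ∧ (∀ i, |s i| ≤ 1) ∧
      ∀ i c c', lo i ≤ c → c' ≤ hi i → ∀ z,
        EMmass d (sortSlice X c c') quant ε z ≤ Real.exp (if i ∈ T then ε else 0) *
          EMmass d (sortSlice X' (c + s i) (c' + s i)) quant ε z := by
  classical
  obtain ⟨x, hx⟩ := Finset.card_eq_one.1 h1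
  obtain ⟨y, hy⟩ := Finset.card_eq_one.1 h2
  have hxm : x ∈ X \ X' := by simp [hx]
  have hym : y ∈ X' \ X := by simp [hy]
  rw [Finset.mem_sdiff] at hxm hym
  have hXe : X = insert x (X ∩ X') := by
    rw [Finset.insert_eq, ← hx, Finset.sdiff_union_inter]
  have hXe' : X' = insert y (X ∩ X') := by
    rw [Finset.insert_eq, ← hy, Finset.inter_comm, Finset.sdiff_union_inter]
  have hxZ : x ∉ X ∩ X' := by simp [hxm.2]
  have hyZ : y ∉ X ∩ X' := by simp [hym.2]
  have hxy : x ≠ y := fun h => hxm.2 (h ▸ hym.1)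
  have hsub : ∀ {V : Finset ℤ} (_ : (V : Set ℤ) ⊆ Set.Icc (0 : ℤ) (d : ℤ)) (c c' : ℤ),
      countLE (sortSlice V c c') d = (sortSlice V c c').card := fun hV c c' =>
    countLE_eq_card fun u hu => (hV (Finset.mem_filter.1 hu).1).2
  have htop : countLE X d = countLE X' d := by
    rw [countLE_eq_card fun u hu => (hX hu).2, countLE_eq_card fun u hu => (hX' hu).2, hcard]
  -- transfer from counting functions to output probabilities
  have transfer_eq : ∀ c c' r : ℤ,
      (∀ z, (countLE (sortSlice X c c') z : ℤ) = countLE (sortSlice X' (c + r) (c' + r)) z) →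
      ∀ z, EMmass d (sortSlice X c c') quant ε z ≤ Real.exp 0 *
        EMmass d (sortSlice X' (c + r) (c' + r)) quant ε z := by
    intro c c' r hz z
    have hz' : ∀ z, countLE (sortSlice X c c') z = countLE (sortSlice X' (c + r) (c' + r)) z :=
      fun z => by exact_mod_cast hz z
    have := EMmass_le (q := quant) (k := 0) d hε (S := sortSlice X c c')
      (S' := sortSlice X' (c + r) (c' + r)) (fun z => by simp [hz' z])
      (by rw [← hsub hX, ← hsub hX', hz']) z
    simpa using this
  have transfer_one : (∀ z, |(countLE X z : ℤ) - countLE X' z| ≤ 1) → ∀ c c' z : ℤ,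
      EMmass d (sortSlice X c c') quant ε z ≤ Real.exp ε *
        EMmass d (sortSlice X' (c + 0) (c' + 0)) quant ε z := by
    intro hz c c' z
    have := EMmass_le (q := quant) (k := 1) d hε (S := sortSlice X c c')
      (S' := sortSlice X' c c') (fun z => by
        have e1 := countLE_sortSlice X c c' z
        have e2 := countLE_sortSlice X' c c' z
        have h3 := abs_le.1 (hz z)
        have : |(countLE (sortSlice X c c') z : ℤ) - countLE (sortSlice X' c c') z| ≤ 1 := by
          rw [abs_le]; omega
        exact_mod_cast this)
      (by
        rw [← hsub hX, ← hsub hX']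
        have e1 := countLE_sortSlice X c c' d
        have e2 := countLE_sortSlice X' c c' d
        rw [htop] at e1
        omega) z
    simpa using this
  rcases lt_or_gt_of_ne hxy with hlt | hlt
  · have hpat := substPattern_insert hxZ hyZ hlt
    rw [← hXe, ← hXe'] at hpat
    obtain ⟨ha, hab, hp⟩ := hpat
    obtain ⟨e, T, hT, he, hi'⟩ := exists_contVec hab lo (fun i => hi i + 1)
      (fun i => by have := hle i; omega) (fun i j h => hsep i j h)
    refine ⟨-e, e, T, hT, he, Or.inr rfl, fun i => ?_, fun i c c' hc hc' => ?_⟩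
    · rcases hi' i with ⟨-, h⟩ | ⟨-, h, -⟩ | ⟨-, h, -⟩ <;> simp [h]
    · rcases hi' i with h | h | h
      · simp only [h.1, if_true, Pi.neg_apply, h.2, neg_zero]
        exact transfer_one (fun z => by rw [abs_le]; have := hp z; omega) c c'
      · simp only [h.1, if_false, Pi.neg_apply, h.2.1]
        refine transfer_eq c c' _ fun z => ?_
        rw [countLE_sortSlice, countLE_sortSlice]
        have := hp z
        omega
      · simp only [h.1, if_false, Pi.neg_apply, h.2.1]
        refine transfer_eq c c' _ fun z => ?_
        rw [countLE_sortSlice, countLE_sortSlice]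
        have := hp z
        omega
  · have hpat := substPattern_insert hyZ hxZ hlt
    rw [← hXe, ← hXe'] at hpat
    obtain ⟨ha, hab, hp⟩ := hpat
    obtain ⟨e, T, hT, he, hi'⟩ := exists_contVec hab lo (fun i => hi i + 1)
      (fun i => by have := hle i; omega) (fun i j h => hsep i j h)
    refine ⟨e, e, T, hT, he, Or.inl rfl, fun i => ?_, fun i c c' hc hc' => ?_⟩
    · rcases hi' i with ⟨-, h⟩ | ⟨-, h, -⟩ | ⟨-, h, -⟩ <;> simp [h]
    · rcases hi' i with h | h | h
      · simp only [h.1, if_true, h.2]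
        exact transfer_one (fun z => by rw [abs_le]; have := hp z; omega) c c'
      · simp only [h.1, if_false, h.2.1]
        refine transfer_eq c c' _ fun z => ?_
        rw [countLE_sortSlice, countLE_sortSlice]
        have := hp z
        omega
      · simp only [h.1, if_false, h.2.1]
        refine transfer_eq c c' _ fun z => ?_
        rw [countLE_sortSlice, countLE_sortSlice]
        have := hp z
        omega

lemma HasCCProperty.le_shift {m : ℕ} {μ : PMF (Fin m → ℤ)} {ε : ℝ} (hε : 0 ≤ ε)
    (hCC : HasCCProperty μ ε) {s e : Fin m → ℤ} (he : e = 0 ∨ ContVec m e)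
    (hs : s = e ∨ s = -e) (η : Fin m → ℤ) :
    μ η ≤ ENNReal.ofReal (Real.exp ε) * μ (η + s) := by
  rcases he with rfl | he
  · have hs0 : s = 0 := by rcases hs with h | h <;> simp [h]
    rw [hs0, add_zero]
    exact le_mul_of_one_le_left zero_le
      (ENNReal.one_le_ofReal.2 (Real.one_le_exp hε))
  · rcases hs with rfl | rfl
    · have := (hCC (η + s) s he).2
      simpa using this
    · have := (hCC η e he).1
      simpa [sub_eq_add_neg, Pi.add_def] using this

/-- Privacy of SlicingEM (Theorem 1): under the SlicingEM setup, for every fixed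
adversarial noise vector `η^A ∈ {0,…,w}^m`, the mechanism `M_{η^A}` is
`(ε, δ·e^ε)`-differentially private with respect to substitution of a single element
among datasets of `n` distinct points of `{0,…,d}`. -/
theorem slicingEM_private
    (ε δ β : ℝ) (hε : 0 < ε) (hδ0 : 0 < δ) (hδ1 : δ < 1) (hβ0 : 0 < β) (hβ1 : β < 1)
    (n m d : ℕ) (hn : 2 ≤ n) (hm : 2 ≤ m) (hd : 1 ≤ d)
    (h w : ℤ)
    (hh : h = ⌈12 / ε * Real.log ((m : ℝ) * ((d : ℝ) + 1) / β)⌉)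
    (hw : w = ⌈24 / ε * Real.logb 2 (m : ℝ) * Real.log (2 * (m : ℝ) / δ)⌉)
    (q : Fin m → ℝ) (hqmono : StrictMono q) (hq : ∀ i, 0 < q i ∧ q i < 1)
    (hgap : ∀ i j : Fin m, (j : ℕ) = (i : ℕ) + 1 →
      2 / (n : ℝ) * ((w : ℝ) + (h : ℝ) + 1) ≤ q j - q i)
    (hlow : 1 ≤ ⌊(n : ℝ) * q ⟨0, by omega⟩⌋ - h - w)
    (hhigh : ⌊(n : ℝ) * q ⟨m - 1, by omega⟩⌋ + h + w ≤ (n : ℤ))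
    (μ : PMF (Fin m → ℤ)) (hCC : HasCCProperty μ (ε / 2))
    (htail : ∀ β' : ℝ, 0 < β' → β' < 1 →
      μ.toOuterMeasure
          {η | ∃ i, 12 / ε * Real.logb 2 (m : ℝ) * Real.log (2 * (m : ℝ) / β')
            ≤ |(η i : ℝ)|} ≤ ENNReal.ofReal β')
    (ηA : Fin m → ℤ) (hηA : ∀ i, 0 ≤ ηA i ∧ ηA i ≤ w) :
    ∀ X X' : Finset ℤ,
      X.card = n → X'.card = n →
      (X : Set ℤ) ⊆ Set.Icc (0 : ℤ) (d : ℤ) → (X' : Set ℤ) ⊆ Set.Icc (0 : ℤ) (d : ℤ) →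
      (X \ X').card = 1 → (X' \ X).card = 1 →
      ∀ Y : Set (Fin m → ℤ),
        (∑' v : Fin m → ℤ,
            Set.indicator Y (slicingEMmass d n m ε h w q (μ.map (clampW w)) ηA X) v)
          ≤ ENNReal.ofReal (Real.exp ε) *
              (∑' v : Fin m → ℤ,
                Set.indicator Y (slicingEMmass d n m ε h w q (μ.map (clampW w)) ηA X') v)
            + ENNReal.ofReal (δ * Real.exp ε) := by
  classical
  intro X X' hXc hX'c hX hX' h1 h2 Y
  have hnpos : (0 : ℝ) < n := by positivity
  have hmR : (2 : ℝ) ≤ m := by exact_mod_cast hm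
  have hlogb : 1 ≤ Real.logb 2 (m : ℝ) := by
    rw [Real.le_logb_iff_rpow_le (by norm_num) (by linarith)]
    simpa using hmR
  have hmδ : 1 < 2 * (m : ℝ) / δ := by
    rw [one_lt_div hδ0]; linarith
  have hlogδ : 0 < Real.log (2 * (m : ℝ) / δ) := Real.log_pos hmδ
  have hw1 : 24 / ε * Real.logb 2 (m : ℝ) * Real.log (2 * (m : ℝ) / δ) ≤ w := by
    rw [hw]; exact Int.le_ceil _
  have hw0 : 0 ≤ w := by
    have : (0 : ℝ) ≤ w := le_trans (by positivity) hw1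
    exact_mod_cast this
  have hh0 : 0 ≤ h := by
    rw [hh]
    refine Int.ceil_nonneg (mul_nonneg (by positivity) (Real.log_nonneg ?_))
    rw [one_le_div hβ0]
    have : (0 : ℝ) ≤ d := Nat.cast_nonneg d
    nlinarith
  have hW : ⌊(w : ℝ) / 2⌋ = w / 2 := by
    have := Int.floor_div_natCast (w : ℝ) 2
    simpa using this
  set W : ℤ := ⌊(w : ℝ) / 2⌋ with hWdef
  set k : Fin m → ℤ := fun i => ⌊(n : ℝ) * q i⌋ with hk
  have hsep : ∀ i j : Fin m, i < j → k i + h + w + 1 < k j - h - w := by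
    intro i j hij
    have hlt : (i : ℕ) + 1 < m := lt_of_le_of_lt hij j.2
    have hg := hgap i ⟨i + 1, hlt⟩ rfl
    have hq' : q ⟨i + 1, hlt⟩ ≤ q j := hqmono.monotone (Fin.le_def.2 hij)
    have hg' : 2 * ((w : ℝ) + h + 1) ≤ n * q j - n * q i := by
      have h3 : 2 / (n : ℝ) * ((w : ℝ) + h + 1) ≤ q j - q i := hg.trans (by linarith)
      have h4 := mul_le_mul_of_nonneg_left h3 hnpos.le
      have h5 : (n : ℝ) * (2 / n * ((w : ℝ) + h + 1)) = 2 * ((w : ℝ) + h + 1) := by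
        field_simp
      linarith
    have : k i + 2 * (w + h + 1) ≤ k j := by
      refine Int.le_floor.2 ?_
      have := Int.floor_le ((n : ℝ) * q i)
      push_cast [hk]
      linarith
    omega
  obtain ⟨s, e, T, hT, he, hs, hs1, hmass⟩ := exists_slice_coupling (m := m) (d := d)
    (ε := ε / 6) (by positivity) (1 / 2) (hXc.trans hX'c.symm) hX hX' h1 h2
    (fun i => k i - h - w) (fun i => k i + h + w) (fun i => by omega) hsep
  -- conditional output mass given the noise vector
  set f : Finset ℤ → (Fin m → ℤ) → (Fin m → ℤ) → ℝ≥0∞ := fun V η v =>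
    ∏ i : Fin m, ENNReal.ofReal (EMmass d (sortSlice V (k i - h + (W + η i - ηA i))
      (k i + h + (W + η i - ηA i))) (1 / 2) (ε / 6) (v i)) with hf
  have hrw : ∀ V : Finset ℤ, (∑' v : Fin m → ℤ,
      Set.indicator Y (slicingEMmass d n m ε h w q (μ.map (clampW w)) ηA V) v) =
        ∑' η, μ η * ∑' v, Set.indicator Y (f V (clampW w η)) v := by
    intro V
    simp only [← ENNReal.tsum_mul_left]
    rw [ENNReal.tsum_comm]
    refine tsum_congr fun v => ?_
    by_cases hv : v ∈ Y
    · simp only [Set.indicator_of_mem hv]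
      exact PMF.tsum_map_mul μ (clampW w) fun η => f V η v
    · simp [Set.indicator_of_notMem hv]
  rw [hrw X, hrw X']
  set B : Set (Fin m → ℤ) := {η | ∃ i, W ≤ |η i|} with hB
  have hBtail : ∑' η, B.indicator μ η ≤ ENNReal.ofReal (δ * Real.exp ε) := by
    rcases le_or_gt 1 (δ * Real.exp ε) with hbig | hsmall
    · exact ((ENNReal.tsum_le_tsum fun η => Set.indicator_le_self B μ η).trans_eq μ.tsum_coe).trans (ENNReal.one_le_ofReal.2 hbig)
    · rw [← PMF.toOuterMeasure_apply]
      refine (MeasureTheory.measure_mono ?_).trans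
        (htail (δ * Real.exp ε) (by positivity) hsmall)
      rintro η ⟨i, hi⟩
      refine ⟨i, ?_⟩
      have hlog : Real.log (2 * (m : ℝ) / (δ * Real.exp ε)) =
          Real.log (2 * (m : ℝ) / δ) - ε := by
        rw [← div_div, Real.log_div (by positivity) (Real.exp_ne_zero _), Real.log_exp]
      have hWle : (w : ℝ) / 2 - 1 ≤ W := (Int.sub_one_lt_floor _).le
      have hηW : (W : ℝ) ≤ |(η i : ℝ)| := by exact_mod_cast hi
      have hcalc : 12 / ε * Real.logb 2 (m : ℝ) * Real.log (2 * (m : ℝ) / (δ * Real.exp ε)) =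
          24 / ε * Real.logb 2 (m : ℝ) * Real.log (2 * (m : ℝ) / δ) / 2 -
            12 * Real.logb 2 (m : ℝ) := by
        rw [hlog]; field_simp; ring
      rw [hcalc]
      linarith
  have hclamp : ∀ η : Fin m → ℤ, (∀ i, |η i| ≤ W) → clampW w η = η := by
    intro η hη
    funext i
    have := abs_le.1 (hη i)
    change max (-W) (min W (η i)) = η i
    omega
  have hfle : ∀ η : Fin m → ℤ, (∀ i, |η i| ≤ W) → ∀ v,
      f X η v ≤ ENNReal.ofReal (Real.exp (ε / 3)) * f X' (η + s) v := by
    intro η hη v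
    have hterm : ∀ i, ENNReal.ofReal (EMmass d (sortSlice X (k i - h + (W + η i - ηA i))
        (k i + h + (W + η i - ηA i))) (1 / 2) (ε / 6) (v i)) ≤
        ENNReal.ofReal (Real.exp (if i ∈ T then ε / 6 else 0)) *
        ENNReal.ofReal (EMmass d (sortSlice X' (k i - h + (W + (η + s) i - ηA i))
        (k i + h + (W + (η + s) i - ηA i))) (1 / 2) (ε / 6) (v i)) := by
      intro i
      rw [← ENNReal.ofReal_mul (Real.exp_pos _).le]
      refine ENNReal.ofReal_le_ofReal ?_
      have hηi := abs_le.1 (hη i)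
      have hA := hηA i
      have := hmass i (k i - h + (W + η i - ηA i)) (k i + h + (W + η i - ηA i))
        (by omega) (by omega) (v i)
      have e1 : k i - h + (W + (η + s) i - ηA i) = k i - h + (W + η i - ηA i) + s i := by
        rw [Pi.add_apply]; ring
      have e2 : k i + h + (W + (η + s) i - ηA i) = k i + h + (W + η i - ηA i) + s i := by
        rw [Pi.add_apply]; ring
      rw [e1, e2]
      exact this
    calc f X η v ≤ _ := Finset.prod_le_prod' fun i _ => hterm i
      _ = ENNReal.ofReal (Real.exp (T.card * (ε / 6))) * f X' (η + s) v := by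
        rw [Finset.prod_mul_distrib,
          ← ENNReal.ofReal_prod_of_nonneg fun i _ => (Real.exp_pos _).le, ← Real.exp_sum,
          Finset.sum_ite_mem, Finset.univ_inter, Finset.sum_const, nsmul_eq_mul]
      _ ≤ _ := by
        gcongr
        have : (T.card : ℝ) ≤ 2 := by exact_mod_cast hT
        nlinarith
  have hpoint : ∀ η, μ η * ∑' v, Set.indicator Y (f X (clampW w η)) v ≤
      B.indicator μ η + ENNReal.ofReal (Real.exp ε) *
        (μ (η + s) * ∑' v, Set.indicator Y (f X' (clampW w (η + s))) v) := by
    intro η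
    by_cases hη : η ∈ B
    · rw [Set.indicator_of_mem hη]
      refine le_add_right (mul_le_of_le_one_right' ?_)
      refine (ENNReal.tsum_le_tsum fun v => Set.indicator_le_self _ _ v).trans ?_
      exact (tsum_prod_EMmass d _ _ _).le
    · rw [Set.indicator_of_notMem hη, zero_add]
      simp only [hB, Set.mem_ofPred_eq, not_exists, not_le] at hη
      have hin : ∀ i, |(η + s) i| ≤ W := fun i => by
        have h3 := abs_add_le (η i) (s i)
        have h4 := hη i
        have h5 := hs1 i
        rw [Pi.add_apply]
        omega
      rw [hclamp η fun i => (hη i).le, hclamp _ hin]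
      calc μ η * ∑' v, Set.indicator Y (f X η) v
          ≤ (ENNReal.ofReal (Real.exp (ε / 2)) * μ (η + s)) *
            (ENNReal.ofReal (Real.exp (ε / 3)) * ∑' v, Set.indicator Y (f X' (η + s)) v) := by
            refine mul_le_mul' (hCC.le_shift (by positivity) he hs η) ?_
            rw [← ENNReal.tsum_mul_left]
            refine ENNReal.tsum_le_tsum fun v => ?_
            by_cases hv : v ∈ Y
            · simp only [Set.indicator_of_mem hv]
              exact hfle η (fun i => (hη i).le) v
            · simp [Set.indicator_of_notMem hv]
        _ = ENNReal.ofReal (Real.exp (ε / 2) * Real.exp (ε / 3)) *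
            (μ (η + s) * ∑' v, Set.indicator Y (f X' (η + s)) v) := by
            rw [ENNReal.ofReal_mul (Real.exp_pos _).le]; ring
        _ ≤ _ := by
            gcongr
            rw [← Real.exp_add, Real.exp_le_exp]
            linarith
  calc ∑' η, μ η * ∑' v, Set.indicator Y (f X (clampW w η)) v
      ≤ ∑' η, (B.indicator μ η + ENNReal.ofReal (Real.exp ε) *
        (μ (η + s) * ∑' v, Set.indicator Y (f X' (clampW w (η + s))) v)) :=
        ENNReal.tsum_le_tsum hpoint
    _ = ∑' η, B.indicator μ η + ENNReal.ofReal (Real.exp ε) *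
        ∑' η, μ η * ∑' v, Set.indicator Y (f X' (clampW w η)) v := by
        rw [ENNReal.tsum_add, ENNReal.tsum_mul_left]
        congr 2
        exact (Equiv.addRight s).tsum_eq
          fun η => μ η * ∑' v, Set.indicator Y (f X' (clampW w η)) v
    _ ≤ _ := by
        rw [add_comm]
        gcongr
end

section
/- Fix integers d ≥ 1, n ≥ 1, M ≥ 1 and thresholds 0 = v'_0 ≤ v'_1 ≤ ⋯ ≤ v'_{M−1} ≤ v'_M = d+1; for a dataset X of n points in {0,…,d} define the bucket counts b_i(X) = #{x ∈ X : v'_{i−1} ≤ x < v'_i} for i = 1,…,M. Let ν be any probability distribution on ℤ^M satisfying the (ε,δ)-CD privacy property. Then for every fixed vector γ^A ∈ ℤ^M, the mechanism X ↦ (∑_{i=1}^M γ_i, (b_i(X) + γ_i + γ^A_i)_{i=1}^M), where γ ∼ ν, is (ε,δ)-differentially private with respect to substitution of a single element among datasets of size n. -/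
open scoped ENNReal

/-- A vector with exactly one `−1` (at index `s`), exactly one `+1` (at index `t ≥ s`),
and zeros elsewhere. -/
def CDNeighborVec (M : ℕ) (e : Fin M → ℤ) : Prop :=
  ∃ s t : Fin M, s ≤ t ∧ e s = -1 ∧ e t = 1 ∧ ∀ i, i ≠ s → i ≠ t → e i = 0

/-- The (ε,δ)-CD privacy property. -/
def CDPrivate (M : ℕ) (ν : PMF (Fin M → ℤ)) (ε δ : ℝ) : Prop :=
  ∀ V : Set (Fin M → ℤ), ∀ e : Fin M → ℤ, CDNeighborVec M e →
    (ν.toOuterMeasure V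
        ≤ ENNReal.ofReal (Real.exp ε) * ν.toOuterMeasure {γ | e + γ ∈ V}
          + ENNReal.ofReal δ) ∧
    (ν.toOuterMeasure {γ | e + γ ∈ V}
        ≤ ENNReal.ofReal (Real.exp ε) * ν.toOuterMeasure V + ENNReal.ofReal δ)

/-- The `i`-th bucket count of the dataset `X : Fin n → ℤ` with respect to the
thresholds `v'`: `b_i(X) = #{x ∈ X : v'_{i−1} ≤ x < v'_i}`. -/
def bucketCount {n M : ℕ} (v' : Fin (M + 1) → ℤ) (X : Fin n → ℤ) (i : Fin M) : ℕ :=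
  (Finset.univ.filter fun j => v' i.castSucc ≤ X j ∧ X j < v' i.succ).card

/-- A point of the range covered by monotone thresholds lies in exactly one bucket. -/
theorem exists_bucket_iff_eq {M : ℕ} {v' : Fin (M + 1) → ℤ} (hmono : Monotone v')
    {x : ℤ} (hx0 : v' 0 ≤ x) (hx1 : x < v' (Fin.last M)) :
    ∃ p : Fin M, ∀ i : Fin M, (v' i.castSucc ≤ x ∧ x < v' i.succ) ↔ i = p := by
  obtain ⟨p, hp⟩ : ∃ p : Fin M, v' p.castSucc ≤ x ∧ x < v' p.succ := by
    by_contra! hcon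
    have key : ∀ i : Fin (M + 1), v' i ≤ x := fun i =>
      Fin.induction (motive := fun i => v' i ≤ x) hx0 hcon i
    exact absurd (key (Fin.last M)) (not_le.mpr hx1)
  refine ⟨p, fun i => ⟨fun hi => ?_, fun hi => hi ▸ hp⟩⟩
  rcases lt_trichotomy i p with h | h | h
  · have : v' i.succ ≤ v' p.castSucc := hmono (Fin.succ_le_castSucc_iff.mpr h)
    omega
  · exact h
  · have : v' p.succ ≤ v' i.castSucc := hmono (Fin.succ_le_castSucc_iff.mpr h)
    omega

/-- Moving one data point from bucket `p` to bucket `q` changes the bucket counts by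
`Pi.single q 1 - Pi.single p 1`. -/
theorem bucketCount_substitute {n M : ℕ} {v' : Fin (M + 1) → ℤ} {X X' : Fin n → ℤ}
    {j₀ : Fin n} (hX : ∀ j, j ≠ j₀ → X j = X' j) {p q : Fin M}
    (hp : ∀ i : Fin M, (v' i.castSucc ≤ X j₀ ∧ X j₀ < v' i.succ) ↔ i = p)
    (hq : ∀ i : Fin M, (v' i.castSucc ≤ X' j₀ ∧ X' j₀ < v' i.succ) ↔ i = q) (i : Fin M) :
    (bucketCount v' X' i : ℤ)
      = bucketCount v' X i + ((Pi.single q 1 : Fin M → ℤ) i - (Pi.single p 1 : Fin M → ℤ) i) := by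
  have hsum : ∑ j ∈ Finset.univ.erase j₀,
        (if v' i.castSucc ≤ X j ∧ X j < v' i.succ then (1 : ℤ) else 0)
      = ∑ j ∈ Finset.univ.erase j₀,
        (if v' i.castSucc ≤ X' j ∧ X' j < v' i.succ then (1 : ℤ) else 0) :=
    Finset.sum_congr rfl fun j hj => by rw [hX j (Finset.ne_of_mem_erase hj)]
  simp only [bucketCount, Finset.card_filter, Nat.cast_sum, Nat.cast_ite, Nat.cast_one,
    Nat.cast_zero]
  rw [← Finset.add_sum_erase _ _ (Finset.mem_univ j₀),
    ← Finset.add_sum_erase Finset.univ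
      (fun j => if v' i.castSucc ≤ X j ∧ X j < v' i.succ then (1 : ℤ) else 0)
      (Finset.mem_univ j₀), hsum]
  simp only [hp, hq, Pi.single_apply]
  ring

/-- The difference of two unit vectors is a neighbor vector when their indices are ordered. -/
theorem cdNeighborVec_single_sub_single {M : ℕ} {s t : Fin M} (h : s < t) :
    CDNeighborVec M (Pi.single t 1 - Pi.single s 1) := by
  refine ⟨s, t, h.le, ?_, ?_, fun i his hit => ?_⟩
  · simp [h.ne]
  · simp [h.ne']
  · simp [his, hit]

/-- Translating the noise by a difference of unit vectors keeps its total and translates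
the noisy counts. -/
theorem noisy_counts_translate {M : ℕ} {b b' γA : Fin M → ℤ} {p q : Fin M}
    (hb : ∀ i, b' i = b i + ((Pi.single q 1 : Fin M → ℤ) i - (Pi.single p 1 : Fin M → ℤ) i))
    (γ : Fin M → ℤ) :
    ((∑ i, γ i), fun i => b' i + γ i + γA i)
      = ((∑ i, (Pi.single q 1 - Pi.single p 1 + γ : Fin M → ℤ) i),
          fun i => b i + (Pi.single q 1 - Pi.single p 1 + γ : Fin M → ℤ) i + γA i) := by
  refine Prod.ext ?_ (funext fun i => ?_)
  · simp [Finset.sum_add_distrib]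
  · simp only [hb, Pi.add_apply, Pi.sub_apply]
    ring

/-- Privacy of the bucketing mechanism: if `ν` satisfies the (ε,δ)-CD property, then
for every fixed adversarial noise `γ^A`, the mechanism
`X ↦ (∑_i γ_i, (b_i(X) + γ_i + γ^A_i)_i)` with `γ ∼ ν` is (ε,δ)-DP under
substitution of a single element among datasets of `n` points of `{0,…,d}`. -/
theorem bucketing_mechanism_private
    (ε δ : ℝ) (hε : 0 < ε) (hδ : 0 ≤ δ)
    (d n M : ℕ) (hd : 1 ≤ d) (hn : 1 ≤ n) (hM : 1 ≤ M)
    (v' : Fin (M + 1) → ℤ) (hmono : Monotone v')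
    (h0 : v' 0 = 0) (hlast : v' (Fin.last M) = (d : ℤ) + 1)
    (ν : PMF (Fin M → ℤ)) (hν : CDPrivate M ν ε δ)
    (γA : Fin M → ℤ) :
    ∀ X X' : Fin n → ℤ,
      (∀ j, X j ∈ Set.Icc (0 : ℤ) d) → (∀ j, X' j ∈ Set.Icc (0 : ℤ) d) →
      (∃ j₀, X j₀ ≠ X' j₀ ∧ ∀ j, j ≠ j₀ → X j = X' j) →
      ∀ Y : Set (ℤ × (Fin M → ℤ)),
        (ν.map fun γ => ((∑ i, γ i),
            fun i => (bucketCount v' X i : ℤ) + γ i + γA i)).toOuterMeasure Y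
          ≤ ENNReal.ofReal (Real.exp ε) *
              (ν.map fun γ => ((∑ i, γ i),
                fun i => (bucketCount v' X' i : ℤ) + γ i + γA i)).toOuterMeasure Y
            + ENNReal.ofReal δ := by
  rintro X X' hX hX' ⟨j₀, -, hj₀⟩ Y
  obtain ⟨p, hp⟩ := exists_bucket_iff_eq hmono (x := X j₀)
    (h0.trans_le (hX j₀).1) (hlast ▸ Int.lt_add_one_of_le (hX j₀).2)
  obtain ⟨q, hq⟩ := exists_bucket_iff_eq hmono (x := X' j₀)
    (h0.trans_le (hX' j₀).1) (hlast ▸ Int.lt_add_one_of_le (hX' j₀).2)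
  have hb := bucketCount_substitute hj₀ hp hq
  have hb' := bucketCount_substitute (fun j hj => (hj₀ j hj).symm) hq hp
  simp only [PMF.toOuterMeasure_map_apply]
  rcases lt_trichotomy p q with h | h | h
  · have key := (hν ((fun γ => ((∑ i, γ i),
      fun i => (bucketCount v' X i : ℤ) + γ i + γA i)) ⁻¹' Y) _
      (cdNeighborVec_single_sub_single h)).1
    simp only [Set.mem_preimage, ← noisy_counts_translate hb] at key
    exact key
  · subst h
    have heq : ∀ i, (bucketCount v' X' i : ℤ) = bucketCount v' X i := fun i => by simp [hb i]
    simp only [heq]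
    refine le_add_right (le_mul_of_one_le_left' ?_)
    exact ENNReal.one_le_ofReal.mpr (Real.one_le_exp hε.le)
  · have key := (hν ((fun γ => ((∑ i, γ i),
      fun i => (bucketCount v' X' i : ℤ) + γ i + γA i)) ⁻¹' Y) _
      (cdNeighborVec_single_sub_single h)).2
    simp only [Set.mem_preimage, ← noisy_counts_translate hb'] at key
    exact key
end

section
/- Run Modified Quicksort on an instance (X, A), and let I_t be one of the maximal intervals of A, of length ℓ_t. The expected number of comparisons performed between pairs of elements whose ranks both lie in I_t is at most 3·ℓ_t. -/
/-- Probability that, when Modified Quicksort is run on the instance `(X, A)` with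
`|X| = n` and `A ⊆ [n]` the set of ranks allowed to stay unordered, the elements of
ranks `i` and `j` (`i ≠ j`) are ever compared.  At each level the pivot rank `p` is
uniform on `[n]`; the two elements are compared at this level iff `p ∈ {i, j}`; if
`p < min i j` both move to the right subinstance (ranks and `A` shifted by `p`); if
`p > max i j` both move to the left subinstance; otherwise they are separated and are
never compared.  If `|A| = n` the algorithm performs no comparisons. -/
noncomputable def cmpProb : ℕ → Finset ℕ → ℕ → ℕ → ℝ
  | n, A, i, j =>
    if A.card = n then 0
    else ((n : ℝ))⁻¹ *
      ∑ p ∈ (Finset.Icc 1 n).attach,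
        (if p.1 = i ∨ p.1 = j then 1
         else if p.1 < min i j then
           cmpProb (n - p.1) ((A.filter fun x => p.1 + 1 ≤ x).image fun x => x - p.1)
             (i - p.1) (j - p.1)
         else if max i j < p.1 then
           cmpProb (p.1 - 1) (A.filter fun x => x ≤ p.1 - 1) i j
         else 0)
  termination_by n _ _ _ => n
  decreasing_by
  · have hp := p.2; simp only [Finset.mem_Icc] at hp; omega
  · have hp := p.2; simp only [Finset.mem_Icc] at hp; omega

lemma cmpProb_eq_zero_of_card_eq {n : ℕ} {A : Finset ℕ} (h : A.card = n) (i j : ℕ) :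
    cmpProb n A i j = 0 := by
  rw [cmpProb, if_pos h]

/-- If every rank is allowed to stay unordered, no comparison is made. -/
lemma cmpProb_eq_zero_of_Icc_subset {n : ℕ} {A : Finset ℕ} (hA : A ⊆ Finset.Icc 1 n)
    (hI : Finset.Icc 1 n ⊆ A) (i j : ℕ) : cmpProb n A i j = 0 :=
  cmpProb_eq_zero_of_card_eq (by simp [Finset.Subset.antisymm hA hI]) i j

/-- The ranks of `A` above the pivot `p`, renumbered within the right subinstance. -/
abbrev rightRanks (A : Finset ℕ) (p : ℕ) : Finset ℕ :=
  (A.filter fun x => p + 1 ≤ x).image fun x => x - p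

/-- The ranks of `A` below the pivot `p`. -/
abbrev leftRanks (A : Finset ℕ) (p : ℕ) : Finset ℕ :=
  A.filter fun x => x ≤ p - 1

lemma rightRanks_subset {n : ℕ} {A : Finset ℕ} (hA : A ⊆ Finset.Icc 1 n) (p : ℕ) :
    rightRanks A p ⊆ Finset.Icc 1 (n - p) := by
  intro x hx
  simp only [Finset.mem_image, Finset.mem_filter] at hx
  obtain ⟨y, ⟨hy, hpy⟩, rfl⟩ := hx
  have := Finset.mem_Icc.1 (hA hy)
  exact Finset.mem_Icc.2 (by omega)

lemma leftRanks_subset {n : ℕ} {A : Finset ℕ} (hA : A ⊆ Finset.Icc 1 n) (p : ℕ) :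
    leftRanks A p ⊆ Finset.Icc 1 (p - 1) := by
  intro x hx
  simp only [Finset.mem_filter] at hx
  have := Finset.mem_Icc.1 (hA hx.1)
  exact Finset.mem_Icc.2 (by omega)

lemma Icc_subset_rightRanks {A : Finset ℕ} {a b p c d : ℕ} (hI : Finset.Icc a b ⊆ A)
    (hc : 1 ≤ c) (hac : a ≤ c + p) (hdb : d + p ≤ b) :
    Finset.Icc c d ⊆ rightRanks A p := by
  intro x hx
  rw [Finset.mem_Icc] at hx
  simp only [Finset.mem_image, Finset.mem_filter]
  exact ⟨x + p, ⟨hI (Finset.mem_Icc.2 (by omega)), by omega⟩, by omega⟩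

lemma Icc_subset_leftRanks {A : Finset ℕ} {a b p d : ℕ} (hI : Finset.Icc a b ⊆ A)
    (hdb : d ≤ b) (hdp : d ≤ p - 1) :
    Finset.Icc a d ⊆ leftRanks A p := by
  intro x hx
  rw [Finset.mem_Icc] at hx
  simp only [Finset.mem_filter]
  exact ⟨hI (Finset.mem_Icc.2 (by omega)), by omega⟩

/-- Bounding `cmpProb` from bounds on the subinstances that contain both elements. -/
lemma cmpProb_le_of_subinstances {n : ℕ} {A : Finset ℕ} {i j : ℕ} (hi : 1 ≤ i) (hij : i < j)
    (hjn : j ≤ n) {B : ℝ} (hB : 0 ≤ B) (f : ℕ → ℝ)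
    (hright : ∀ p ∈ Finset.Ico 1 i,
      cmpProb (n - p) (rightRanks A p) (i - p) (j - p) ≤ f p)
    (hleft : ∀ p ∈ Finset.Ico (j + 1) (n + 1), cmpProb (p - 1) (leftRanks A p) i j ≤ f p)
    (hsum : ∑ p ∈ Finset.Ico 1 i, f p + 2 + ∑ p ∈ Finset.Ico (j + 1) (n + 1), f p ≤ n * B) :
    cmpProb n A i j ≤ B := by
  rw [cmpProb]
  split_ifs with h
  · exact hB
  have hn : (0 : ℝ) < n := by exact_mod_cast (by omega : 0 < n)
  rw [inv_mul_le_iff₀ hn]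
  refine le_trans ?_ hsum
  rw [Finset.sum_attach (Finset.Icc 1 n) (fun p =>
    (if p = i ∨ p = j then 1
         else if p < min i j then
           cmpProb (n - p) (rightRanks A p) (i - p) (j - p)
         else if max i j < p then
           cmpProb (p - 1) (leftRanks A p) i j
         else 0 : ℝ))]
  rw [min_eq_left hij.le, max_eq_right hij.le]
  have hIcc : Finset.Icc 1 n = Finset.Ico 1 (n + 1) := by
    ext
    simp only [Finset.mem_Icc, Finset.mem_Ico]
    omega
  rw [hIcc, ← Finset.sum_Ico_consecutive _ hi (by omega : i ≤ n + 1),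
    ← Finset.sum_Ico_consecutive _ (by omega : i ≤ j + 1) (by omega : j + 1 ≤ n + 1),
    add_assoc]
  refine add_le_add (Finset.sum_le_sum fun p hp => ?_)
    (add_le_add ?_ (Finset.sum_le_sum fun p hp => ?_))
  · have := Finset.mem_Ico.1 hp
    rw [if_neg (by omega), if_pos (by omega)]
    exact hright p hp
  · rw [Finset.sum_Ico_succ_top hij.le, Finset.sum_eq_sum_Ico_succ_bot hij, if_pos (by simp),
      if_pos (by simp), Finset.sum_eq_zero]
    · norm_num
    · intro p hp
      have := Finset.mem_Ico.1 hp
      rw [if_neg (by omega), if_neg (by omega), if_neg (by omega)]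
  · have := Finset.mem_Ico.1 hp
    rw [if_neg (by omega), if_neg (by omega), if_pos (by omega)]
    exact hleft p hp

lemma sum_Ico_ite_lt {a m b : ℕ} (ham : a ≤ m) (hmb : m ≤ b) (x y : ℝ) :
    ∑ p ∈ Finset.Ico a b, (if p < m then x else y) = ((m : ℝ) - a) * x + ((b : ℝ) - m) * y := by
  rw [← Finset.sum_Ico_consecutive _ ham hmb,
    Finset.sum_congr rfl fun p hp => if_pos (Finset.mem_Ico.1 hp).2,
    Finset.sum_congr (s₁ := Finset.Ico m b) rfl
      fun p hp => if_neg (not_lt.2 (Finset.mem_Ico.1 hp).1)]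
  simp [Nat.cast_sub ham, Nat.cast_sub hmb]

/-- Bound for an interval of unordered ranks that starts at the smallest rank. -/
lemma cmpProb_le_of_Icc_one_subset (n : ℕ) : ∀ (A : Finset ℕ) (b i j : ℕ),
    A ⊆ Finset.Icc 1 n → Finset.Icc 1 b ⊆ A → 1 ≤ i → i < j → j ≤ b → b ≤ n →
    cmpProb n A i j ≤ 2 / ((b : ℝ) - i + 2) := by
  induction n using Nat.strong_induction_on with
  | _ n ih =>
  intro A b i j hA hI hi hij hjb hbn
  have hib : (i : ℝ) ≤ b := by exact_mod_cast (by omega : i ≤ b)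
  have hpos : (0 : ℝ) < (b : ℝ) - i + 2 := by linarith
  have hB : 0 ≤ 2 / ((b : ℝ) - i + 2) := by positivity
  obtain rfl | hbn := hbn.eq_or_lt
  · rw [cmpProb_eq_zero_of_Icc_subset hA hI]; exact hB
  refine cmpProb_le_of_subinstances hi hij (by omega) hB
    (fun p => if p < i then 2 / ((b : ℝ) - i + 2) else
      if p < b + 2 then 0 else 2 / ((b : ℝ) - i + 2)) ?_ ?_ ?_
  · intro p hp
    have hp := Finset.mem_Ico.1 hp
    rw [if_pos hp.2]
    convert ih (n - p) (by omega) (rightRanks A p) (b - p) (i - p) (j - p)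
      (rightRanks_subset hA p) (Icc_subset_rightRanks hI le_rfl (by omega) (by omega))
      (by omega) (by omega) (by omega) (by omega) using 2
    rw [Nat.cast_sub (by omega), Nat.cast_sub (by omega)]
    ring
  · intro p hp
    have hp := Finset.mem_Ico.1 hp
    rw [if_neg (by omega)]
    split_ifs with h
    · rw [cmpProb_eq_zero_of_Icc_subset (leftRanks_subset hA p)
        (Icc_subset_leftRanks hI (by omega) le_rfl)]
    · exact ih (p - 1) (by omega) (leftRanks A p) b i j (leftRanks_subset hA p)
        (Icc_subset_leftRanks hI le_rfl (by omega)) hi hij hjb (by omega)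
  · rw [Finset.sum_congr rfl fun p hp => if_pos (Finset.mem_Ico.1 hp).2,
      Finset.sum_congr (s₁ := Finset.Ico (j + 1) (n + 1)) rfl
        fun p hp => if_neg (by have := Finset.mem_Ico.1 hp; omega),
      sum_Ico_ite_lt (by omega) (by omega)]
    simp only [Finset.sum_const, Nat.card_Ico, nsmul_eq_mul, Nat.cast_sub hi]
    push_cast
    apply le_of_eq
    field_simp
    ring

/-- Bound for an interval of unordered ranks that ends at the largest rank. -/
lemma cmpProb_le_of_Icc_self_subset (n : ℕ) : ∀ (A : Finset ℕ) (a i j : ℕ),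
    A ⊆ Finset.Icc 1 n → Finset.Icc a n ⊆ A → 1 ≤ a → a ≤ i → i < j → j ≤ n →
    cmpProb n A i j ≤ 2 / ((j : ℝ) - a + 2) := by
  induction n using Nat.strong_induction_on with
  | _ n ih =>
  intro A a i j hA hI ha hai hij hjn
  have haj : (a : ℝ) ≤ j := by exact_mod_cast (by omega : a ≤ j)
  have hpos : (0 : ℝ) < (j : ℝ) - a + 2 := by linarith
  have hB : 0 ≤ 2 / ((j : ℝ) - a + 2) := by positivity
  obtain rfl | ha := ha.eq_or_lt
  · rw [cmpProb_eq_zero_of_Icc_subset hA hI]; exact hB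
  refine cmpProb_le_of_subinstances (by omega) hij hjn hB
    (fun p => if j < p then 2 / ((j : ℝ) - a + 2) else
      if p < a - 1 then 2 / ((j : ℝ) - a + 2) else 0) ?_ ?_ ?_
  · intro p hp
    have hp := Finset.mem_Ico.1 hp
    rw [if_neg (by omega)]
    split_ifs with h
    · convert ih (n - p) (by omega) (rightRanks A p) (a - p) (i - p) (j - p)
        (rightRanks_subset hA p)
        (Icc_subset_rightRanks hI (by omega) (by omega) (by omega))
        (by omega) (by omega) (by omega) (by omega) using 2
      rw [Nat.cast_sub (by omega), Nat.cast_sub (by omega)]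
      ring
    · rw [cmpProb_eq_zero_of_Icc_subset (rightRanks_subset hA p)
        (Icc_subset_rightRanks hI le_rfl (by omega) (by omega))]
  · intro p hp
    have hp := Finset.mem_Ico.1 hp
    rw [if_pos (by omega)]
    exact ih (p - 1) (by omega) (leftRanks A p) a i j (leftRanks_subset hA p)
      (Icc_subset_leftRanks hI (by omega) le_rfl) (by omega) hai hij (by omega)
  · rw [Finset.sum_congr (s₁ := Finset.Ico 1 i) rfl
        fun p hp => if_neg (by have := Finset.mem_Ico.1 hp; omega),
      Finset.sum_congr (s₁ := Finset.Ico (j + 1) (n + 1)) rfl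
        fun p hp => if_pos (by have := Finset.mem_Ico.1 hp; omega),
      sum_Ico_ite_lt (by omega) (by omega)]
    simp only [Finset.sum_const, Nat.card_Ico, nsmul_eq_mul, Nat.cast_sub ha.le,
      Nat.cast_sub (by omega : j + 1 ≤ n + 1)]
    push_cast
    apply le_of_eq
    field_simp
    ring

/-- Bound on the probability that two elements of an interval `[a, b]` of unordered ranks are
compared. -/
lemma cmpProb_le_of_Icc_subset (n : ℕ) : ∀ (A : Finset ℕ) (a b i j : ℕ),
    A ⊆ Finset.Icc 1 n → Finset.Icc a b ⊆ A → 1 ≤ a → a ≤ i → i < j → j ≤ b → b ≤ n →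
    cmpProb n A i j ≤
      2 / ((j : ℝ) - a + 2) + 2 / ((b : ℝ) - i + 2) - 2 / ((b : ℝ) - a + 3) := by
  induction n using Nat.strong_induction_on with
  | _ n ih =>
  intro A a b i j hA hI ha hai hij hjb hbn
  have hai' : (a : ℝ) ≤ i := by exact_mod_cast hai
  have hij' : (i : ℝ) + 1 ≤ j := by exact_mod_cast hij
  have hjb' : (j : ℝ) ≤ b := by exact_mod_cast hjb
  have hL : (0 : ℝ) < (j : ℝ) - a + 2 := by linarith
  have hR : (0 : ℝ) < (b : ℝ) - i + 2 := by linarith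
  have hM : (0 : ℝ) < (b : ℝ) - a + 3 := by linarith
  have hL0 : 0 ≤ 2 / ((j : ℝ) - a + 2) := by positivity
  have hR0 : 0 ≤ 2 / ((b : ℝ) - i + 2) := by positivity
  have hML : 2 / ((b : ℝ) - a + 3) ≤ 2 / ((j : ℝ) - a + 2) :=
    div_le_div_of_nonneg_left (by norm_num) hL (by linarith)
  have hMR : 2 / ((b : ℝ) - a + 3) ≤ 2 / ((b : ℝ) - i + 2) :=
    div_le_div_of_nonneg_left (by norm_num) hR (by linarith)
  obtain rfl | ha := ha.eq_or_lt
  · linarith [cmpProb_le_of_Icc_one_subset n A b i j hA hI hai hij hjb hbn]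
  obtain rfl | hbn := hbn.eq_or_lt
  · linarith [cmpProb_le_of_Icc_self_subset b A a i j hA hI ha.le hai hij hjb]
  set P := 2 / ((j : ℝ) - a + 2) + 2 / ((b : ℝ) - i + 2) - 2 / ((b : ℝ) - a + 3) with hP
  refine cmpProb_le_of_subinstances (by omega) hij (by omega) (by linarith)
    (fun p => if p < i then (if p < a - 1 then P else 2 / ((b : ℝ) - i + 2)) else
      (if p < b + 2 then 2 / ((j : ℝ) - a + 2) else P)) ?_ ?_ ?_
  · intro p hp
    have hp := Finset.mem_Ico.1 hp
    rw [if_pos hp.2]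
    split_ifs with h
    · convert ih (n - p) (by omega) (rightRanks A p) (a - p) (b - p) (i - p) (j - p)
        (rightRanks_subset hA p)
        (Icc_subset_rightRanks hI (by omega) (by omega) (by omega))
        (by omega) (by omega) (by omega) (by omega) (by omega) using 1
      rw [hP, Nat.cast_sub (by omega), Nat.cast_sub (by omega), Nat.cast_sub (by omega),
        Nat.cast_sub (by omega)]
      simp only [sub_sub_sub_cancel_right]
    · convert cmpProb_le_of_Icc_one_subset (n - p) (rightRanks A p) (b - p) (i - p) (j - p)
        (rightRanks_subset hA p)
        (Icc_subset_rightRanks hI le_rfl (by omega) (by omega))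
        (by omega) (by omega) (by omega) (by omega) using 2
      rw [Nat.cast_sub (by omega), Nat.cast_sub (by omega)]
      ring
  · intro p hp
    have hp := Finset.mem_Ico.1 hp
    rw [if_neg (by omega)]
    split_ifs with h
    · exact cmpProb_le_of_Icc_self_subset (p - 1) (leftRanks A p) a i j (leftRanks_subset hA p)
        (Icc_subset_leftRanks hI (by omega) le_rfl) ha.le hai hij (by omega)
    · exact ih (p - 1) (by omega) (leftRanks A p) a b i j (leftRanks_subset hA p)
        (Icc_subset_leftRanks hI le_rfl (by omega)) ha.le hai hij hjb (by omega)
  · rw [Finset.sum_congr (s₁ := Finset.Ico 1 i) rfl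
        fun p hp => if_pos (Finset.mem_Ico.1 hp).2,
      Finset.sum_congr (s₁ := Finset.Ico (j + 1) (n + 1)) rfl
        fun p hp => if_neg (by have := Finset.mem_Ico.1 hp; omega),
      sum_Ico_ite_lt (by omega) (by omega), sum_Ico_ite_lt (by omega) (by omega)]
    push_cast [Nat.cast_sub ha.le]
    have hPM : ((b : ℝ) - a + 3) * P =
        2 + ((i : ℝ) - a + 1) * (2 / ((b : ℝ) - i + 2)) +
          ((b : ℝ) - j + 1) * (2 / ((j : ℝ) - a + 2)) := by
      rw [hP]
      field_simp
      ring
    linarith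

/-- Each summand of the rearranged double sum is at most `3`. -/
lemma interval_summand_le {ℓ x y : ℝ} (hx : 0 ≤ x) (hy : 0 ≤ y) (hxy : x + y = ℓ - 1) :
    x * (2 / (x + 2) - 1 / (ℓ + 2)) + y * (2 / (y + 2) - 1 / (ℓ + 2)) ≤ 3 := by
  have hℓ : 1 ≤ ℓ := by linarith
  have key : ∀ z : ℝ, 0 ≤ z → z ≤ ℓ - 1 → z * (2 / (z + 2)) ≤ 2 - 4 / (ℓ + 2) := by
    intro z hz hzℓ
    have h1 : z * (2 / (z + 2)) = 2 - 4 / (z + 2) := by field_simp; ring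
    have h2 : 4 / (ℓ + 2) ≤ 4 / (z + 2) :=
      div_le_div_of_nonneg_left (by norm_num) (by linarith) (by linarith)
    linarith
  have h1 := key x hx (by linarith)
  have h2 := key y hy (by linarith)
  have h3 : (x + y) * (1 / (ℓ + 2)) = 1 - 3 / (ℓ + 2) := by
    rw [hxy]
    field_simp
    ring
  have h4 : 4 / (ℓ + 2) = 4 * (1 / (ℓ + 2)) := by ring
  have h5 : 3 / (ℓ + 2) = 3 * (1 / (ℓ + 2)) := by ring
  have h6 : 0 ≤ 1 / (ℓ + 2) := by positivity
  linarith

/-- The expected number of comparisons performed by Modified Quicksort on `(X, A)`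
between pairs of elements whose ranks both lie in a maximal interval
`I_t = {a, …, a+ℓ−1}` of `A` — i.e., the sum over pairs `a ≤ i < j ≤ a+ℓ−1`
of the probability that they are ever compared — is at most `3ℓ`. -/
theorem expected_within_interval_comparisons
    (n : ℕ) (A : Finset ℕ) (hA : A ⊆ Finset.Icc 1 n)
    (a ℓ : ℕ) (ha : 1 ≤ a) (hℓ : 1 ≤ ℓ) (hub : a + ℓ - 1 ≤ n)
    (hI : Finset.Icc a (a + ℓ - 1) ⊆ A)
    (hleft : a - 1 ∉ A) (hright : a + ℓ ∉ A) :
    ∑ i ∈ Finset.Icc a (a + ℓ - 1), ∑ j ∈ Finset.Icc (i + 1) (a + ℓ - 1),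
        cmpProb n A i j
      ≤ 3 * (ℓ : ℝ) := by
  have hIcc : ∀ c, Finset.Icc c (a + ℓ - 1) = Finset.Ico c (a + ℓ) := by
    intro c; ext x; simp only [Finset.mem_Icc, Finset.mem_Ico]; omega
  have hcast : ((a + ℓ - 1 : ℕ) : ℝ) = (a : ℝ) + ℓ - 1 := by
    rw [Nat.cast_sub (by omega)]; push_cast; ring
  have hpair : ∀ i ∈ Finset.Ico a (a + ℓ), ∀ j ∈ Finset.Ico (i + 1) (a + ℓ),
      cmpProb n A i j ≤ (2 / (((j : ℝ) - a) + 2) - 1 / ((ℓ : ℝ) + 2)) +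
        (2 / (((a : ℝ) + ℓ - 1 - i) + 2) - 1 / ((ℓ : ℝ) + 2)) := by
    intro i hi j hj
    rw [Finset.mem_Ico] at hi hj
    have h := cmpProb_le_of_Icc_subset n A a (a + ℓ - 1) i j hA hI ha hi.1 (by omega)
      (by omega) hub
    rw [hcast, show (a : ℝ) + ℓ - 1 - a + 3 = ℓ + 2 by ring] at h
    have h2 : 2 / ((ℓ : ℝ) + 2) = 1 / ((ℓ : ℝ) + 2) + 1 / ((ℓ : ℝ) + 2) := by ring
    linarith
  simp only [hIcc]
  refine (Finset.sum_le_sum fun i hi => Finset.sum_le_sum (hpair i hi)).trans ?_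
  simp only [Finset.sum_add_distrib]
  rw [Finset.sum_Ico_Ico_comm', ← Finset.sum_add_distrib]
  have hterm : ∀ k ∈ Finset.Ico a (a + ℓ),
      ∑ _i ∈ Finset.Ico a k, (2 / (((k : ℝ) - a) + 2) - 1 / ((ℓ : ℝ) + 2)) +
        ∑ _j ∈ Finset.Ico (k + 1) (a + ℓ),
          (2 / (((a : ℝ) + ℓ - 1 - k) + 2) - 1 / ((ℓ : ℝ) + 2)) ≤ 3 := by
    intro k hk
    rw [Finset.mem_Ico] at hk
    have hak : (a : ℝ) ≤ k := by exact_mod_cast hk.1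
    have hkb : (k : ℝ) + 1 ≤ a + ℓ := by exact_mod_cast hk.2
    rw [Finset.sum_const, Finset.sum_const, Nat.card_Ico, Nat.card_Ico, nsmul_eq_mul,
      nsmul_eq_mul, Nat.cast_sub hk.1, Nat.cast_sub (by omega : k + 1 ≤ a + ℓ)]
    push_cast
    rw [show (a : ℝ) + ℓ - (k + 1) = (a : ℝ) + ℓ - 1 - k by ring]
    exact interval_summand_le (by linarith) (by linarith) (by ring)
  refine (Finset.sum_le_card_nsmul _ _ 3 hterm).trans (le_of_eq ?_)
  rw [Nat.card_Ico, nsmul_eq_mul, Nat.add_sub_cancel_left, mul_comm]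
end

section
/- Let a ≥ 1, ℓ ≥ 1 and n be integers with a + ℓ − 1 ≤ n. Then ∑_{i=a}^{a+ℓ−1} (H_i − H_{i−a+1}) ≤ ℓ·(H_n − H_ℓ) + ℓ − H_ℓ. -/
/-- `H m = ∑_{i=1}^m 1/i`, the m-th harmonic number. -/
noncomputable def H (m : ℕ) : ℝ := ∑ i ∈ Finset.Icc 1 m, (1 : ℝ) / i

theorem H_succ (m : ℕ) : H (m + 1) = H m + 1 / ((m : ℝ) + 1) := by
  simp [H, Finset.sum_Icc_succ_top]

theorem H_mono : Monotone H :=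
  monotone_nat_of_le_succ fun m => by
    rw [H_succ]
    exact le_add_of_nonneg_right (by positivity)

theorem sum_range_H_succ (m : ℕ) :
    ∑ j ∈ Finset.range m, H (j + 1) = ((m : ℝ) + 1) * H m - m := by
  induction m with
  | zero => simp [H]
  | succ k ih =>
    rw [Finset.sum_range_succ, ih, H_succ]
    push_cast
    field_simp
    ring

/-- Arithmetic estimate used to bound the expected number of cross-interval comparisons:
∑_{i=a}^{a+ℓ−1} (H_i − H_{i−a+1}) ≤ ℓ·(H_n − H_ℓ) + ℓ − H_ℓ. -/
theorem cross_interval_harmonic_bound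
    (a ℓ n : ℕ) (ha : 1 ≤ a) (hℓ : 1 ≤ ℓ) (hn : a + ℓ - 1 ≤ n) :
    ∑ i ∈ Finset.Icc a (a + ℓ - 1), (H i - H (i - a + 1))
      ≤ (ℓ : ℝ) * (H n - H ℓ) + (ℓ : ℝ) - H ℓ := by
  have h_icc : Finset.Icc a (a + ℓ - 1) = Finset.Ico a (a + ℓ) := by
    ext i
    simp only [Finset.mem_Icc, Finset.mem_Ico]
    omega
  rw [h_icc, Finset.sum_Ico_eq_sum_range, Nat.add_sub_cancel_left]
  simp only [Nat.add_sub_cancel_left]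
  rw [Finset.sum_sub_distrib, sum_range_H_succ]
  have h_le : ∑ j ∈ Finset.range ℓ, H (a + j) ≤ ℓ * H n := by
    calc _ ≤ ∑ _j ∈ Finset.range ℓ, H n := Finset.sum_le_sum fun j hj => H_mono (by
            have := Finset.mem_range.mp hj
            omega)
      _ = ℓ * H n := by simp
  linarith
end

section
/- Let d > 0 be a real number, let w ≥ 0 and N > 2w be integers, and let y_1 < y_2 < ⋯ < y_N be real numbers with 0 < y_i < d for all i. Let η₀, η₁ ∈ {0,…,w}. Define y'_i = y_i + d for 1 ≤ i ≤ η₀, y'_i = y_i − d for N − η₁ < i ≤ N, and y'_i = y_i otherwise, and let z_1 ≤ z_2 ≤ ⋯ ≤ z_N be the multiset {y'_1,…,y'_N} arranged in sorted order. Then for every index i with w < i ≤ N − w, z_i = y_{i + η₀ − η₁}. In other words, masking the first η₀ entries of a sorted slice upward by d, masking the last η₁ entries downward by d, re-sorting, and discarding w entries from each end yields exactly the original sorted sequence shifted by Δ = η₀ − η₁. -/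
/-- Correctness of the secure-shifting step of SlicingEM.  `y 1 < ⋯ < y N` is a sorted
slice with values in `(0, d)`.  The first `η₀` entries are masked upward by `d`, the
last `η₁` entries are masked downward by `d`, and `z 1 ≤ ⋯ ≤ z N` is the re-sorted
masked sequence (i.e. `z` is monotone on `{1,…,N}` and equals the masked sequence up
to a permutation `σ` of `{1,…,N}`).  Then discarding `w` entries from each end
recovers the original sorted sequence shifted by `Δ = η₀ − η₁`:
for every `w < i ≤ N − w`, `z i = y (i + η₀ − η₁)`. -/
theorem secure_shifting_correct
    (d : ℝ) (hd : 0 < d) (w N : ℕ) (hN : 2 * w < N)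
    (y : ℕ → ℝ) (hy : StrictMonoOn y (Set.Icc 1 N))
    (hrange : ∀ i ∈ Set.Icc 1 N, 0 < y i ∧ y i < d)
    (η₀ η₁ : ℕ) (hη₀ : η₀ ≤ w) (hη₁ : η₁ ≤ w)
    (z : ℕ → ℝ) (hz : MonotoneOn z (Set.Icc 1 N))
    (σ : ℕ → ℕ) (hσ : Set.BijOn σ (Set.Icc 1 N) (Set.Icc 1 N))
    (hzy : ∀ i ∈ Set.Icc 1 N,
      z i = if σ i ≤ η₀ then y (σ i) + d
            else if N - η₁ < σ i then y (σ i) - d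
            else y (σ i)) :
    ∀ i : ℕ, w < i → i ≤ N - w → z i = y (i + η₀ - η₁) := by
  intro i hwi hiN
  simp only [Set.mem_Icc] at hrange hzy
  obtain ⟨m, hm⟩ : ∃ m, m = i + η₀ - η₁ := ⟨_, rfl⟩
  rw [← hm]
  have hm1 : η₀ < m := by omega
  have hm2 : m ≤ N - η₁ := by omega
  have hmI : m ∈ Set.Icc 1 N := Set.mem_Icc.2 ⟨by omega, by omega⟩
  obtain ⟨k, hk, hkm⟩ := hσ.surjOn hmI
  have hzk : z k = y m := by
    rw [hzy k hk, hkm, if_neg (by omega), if_neg (by omega)]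
  have hrm := hrange m hmI
  have hlt : ∀ l ∈ Set.Icc 1 N,
      (z l < y m ↔ N - η₁ < σ l ∨ (η₀ < σ l ∧ σ l < m)) := by
    intro l hl
    have hs := hσ.mapsTo hl
    have hrl := hrange _ hs
    rw [hzy l hl]
    split_ifs with h1 h2
    · exact iff_of_false (by linarith) (by omega)
    · exact iff_of_true (by linarith) (Or.inl h2)
    · rw [hy.lt_iff_lt hs hmI]
      omega
  have heq : ∀ l ∈ Set.Icc 1 N, z l = y m → l = k := by
    intro l hl h
    have hs := hσ.mapsTo hl
    have hrl := hrange _ hs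
    rw [hzy l hl] at h
    split_ifs at h with h1 h2
    · linarith
    · linarith
    · exact hσ.injOn hl hk ((hy.injOn hs hmI h).trans hkm.symm)
  have hcard : (Finset.Ico 1 k).card = (Finset.Ioc (N - η₁) N ∪ Finset.Ioo η₀ m).card := by
    have hbelow : ∀ l ∈ Set.Icc 1 N, (l < k ↔ z l < y m) := by
      intro l hl
      constructor
      · intro h
        exact lt_of_le_of_ne (hzk ▸ hz hl hk h.le) fun h' => h.ne (heq l hl h')
      · intro h
        by_contra! hkl
        exact absurd (hz hk hl hkl) (by rw [hzk]; exact not_le.2 h)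
    have hsub : ∀ l ∈ Finset.Ico 1 k, l ∈ Set.Icc 1 N := by
      intro l hl
      rw [Finset.mem_Ico] at hl
      exact ⟨hl.1, hl.2.le.trans hk.2⟩
    refine Finset.card_bij (fun l _ => σ l) ?_ ?_ ?_
    · intro l hl
      have hlI := hsub l hl
      have hs := hσ.mapsTo hlI
      have := (hlt l hlI).1 ((hbelow l hlI).1 (Finset.mem_Ico.1 hl).2)
      simp only [Finset.mem_union, Finset.mem_Ioc, Finset.mem_Ioo]
      exact this.imp_left fun h => ⟨h, hs.2⟩
    · intro a ha b hb h
      exact hσ.injOn (hsub a ha) (hsub b hb) h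
    · intro b hb
      simp only [Finset.mem_union, Finset.mem_Ioc, Finset.mem_Ioo] at hb
      obtain ⟨l, hl, rfl⟩ := hσ.surjOn (Set.mem_Icc.2 (by omega) : b ∈ Set.Icc 1 N)
      have hlk := (hbelow l hl).2 ((hlt l hl).2 (hb.imp_left And.left))
      exact ⟨l, Finset.mem_Ico.2 ⟨hl.1, hlk⟩, rfl⟩
  rw [Finset.card_union_of_disjoint, Nat.card_Ico, Nat.card_Ioc, Nat.card_Ioo] at hcard
  · have hk1 := hk.1
    obtain rfl : k = i := by omega
    exact hzk
  · rw [Finset.disjoint_left]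
    intro a ha hb
    rw [Finset.mem_Ioc] at ha
    rw [Finset.mem_Ioo] at hb
    omega
end
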